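/- arXiv:0912.5472 — 3 statements merged into one kernel-verified Lean document; each statement's English description precedes it below -/
import Mathlib

section
/- Let g be a finite-dimensional real simple Lie algebra whose Killing form is negative definite, with dim g = n > 4. Suppose the linear map K : g → End(g), Z ↦ K_Z, takes values in skew-symmetric endomorphisms and the alternating bilinear map Φ : g × g → g satisfy (i) σ_{XYZ}⟨Φ(X,Y),Z⟩ = 0 and (ii) σ_{XYZ}([ad_{[X,Y]}, K_Z] + ad_{[K_X Y − K_Y X, Z]} + Φ(X,Y)∧Z) = 0 for all X,Y,Z ∈ g. Then Φ = 0 and for every Z ∈ g there exists U ∈ g such that K_Z = ad_U. -/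
open LieAlgebra

/-- The inner product `⟨X,Y⟩ = -κ(X,Y)`, the negative of the Killing form. -/
noncomputable def ip (R : Type*) (g : Type*) [CommRing R] [LieRing g] [LieAlgebra R g]
    (X Y : g) : R :=
  - killingForm R g X Y

/-- The endomorphism `X ∧ Y : Z ↦ ⟨X,Z⟩Y - ⟨Y,Z⟩X`, where `⟨·,·⟩ = -κ(·,·)`. -/
noncomputable def wedge (R : Type*) (g : Type*) [CommRing R] [LieRing g] [LieAlgebra R g]
    (X Y : g) : Module.End R g :=
  (-(killingForm R g X)).smulRight Y - (-(killingForm R g Y)).smulRight X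

/-- An orthonormal frame `e` of a Lie algebra with respect to an invariant symmetric form `B`
for which the Casimir operator `∑ ad(eᵢ)²` of the adjoint representation is `-1`. -/
structure IsCasimirFrame {g ι : Type*} [LieRing g] [LieAlgebra ℝ g] [Fintype ι]
    (B : g →ₗ[ℝ] g →ₗ[ℝ] ℝ) (e : ι → g) : Prop where
  symm : ∀ x y, B x y = B y x
  inv : ∀ x y z : g, B ⁅x, y⁆ z = B x ⁅y, z⁆
  expand : ∀ x, ∑ i, B x (e i) • e i = x
  norm_sq : ∀ i, B (e i) (e i) = 1
  casimir : ∀ x : g, ∑ i, ⁅e i, ⁅e i, x⁆⁆ = -x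

namespace IsCasimirFrame

variable {g ι : Type*} [LieRing g] [LieAlgebra ℝ g] [Fintype ι]
  {B : g →ₗ[ℝ] g →ₗ[ℝ] ℝ} {e : ι → g} {V : Type*} [AddCommGroup V] [Module ℝ V]

theorem ext_form (h : IsCasimirFrame B e) {x y : g} (hxy : ∀ z, B x z = B y z) : x = y := by
  rw [← h.expand x, ← h.expand y]
  simp [hxy]

theorem inv_left (h : IsCasimirFrame B e) (x y z : g) : B ⁅x, y⁆ z = -B y ⁅x, z⁆ := by
  rw [← lie_skew x y, map_neg, LinearMap.neg_apply, h.inv]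

/-- Parseval's identity for a bilinear map. -/
theorem sum_expand (h : IsCasimirFrame B e) (f : g → V)
    (hf : IsLinearMap ℝ f) (x : g) :
    ∑ i, B x (e i) • f (e i) = f x := by
  have := congrArg (hf.mk' f) (h.expand x)
  rw [map_sum] at this
  simpa only [map_smul, IsLinearMap.mk'_apply] using this

/-- Moving an endomorphism across a contraction of a bilinear map. -/
theorem sum_adjoint (h : IsCasimirFrame B e) {P Q : g → g} (hPQ : ∀ x y, B (P x) y = B x (Q y))
    (f : g → g → V)
    (hf : IsBilinearMap ℝ f) :
    ∑ i, f (P (e i)) (e i) = ∑ i, f (e i) (Q (e i)) := by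
  have h1 : ∀ i, f (P (e i)) (e i) = ∑ j, B (P (e i)) (e j) • f (e j) (e i) := fun i =>
    (h.sum_expand (fun x => f x (e i)) ⟨fun _ _ => hf.add_left _ _ _,
      fun _ _ => hf.smul_left _ _ _⟩ _).symm
  have h2 : ∀ i, f (e i) (Q (e i)) = ∑ j, B (Q (e i)) (e j) • f (e i) (e j) := fun i =>
    (h.sum_expand (fun x => f (e i) x) ⟨fun _ _ => hf.add_right _ _ _,
      fun _ _ => hf.smul_right _ _ _⟩ _).symm
  simp only [h1, h2]
  rw [Finset.sum_comm]
  refine Finset.sum_congr rfl fun i _ => Finset.sum_congr rfl fun j _ => ?_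
  rw [hPQ, h.symm]

theorem sum_lie (h : IsCasimirFrame B e) (w : g)
    (f : g → g → V)
    (hf : IsBilinearMap ℝ f) :
    ∑ i, f ⁅e i, w⁆ (e i) = - ∑ i, f (e i) ⁅e i, w⁆ := by
  rw [h.sum_adjoint (P := fun x => ⁅x, w⁆) (Q := fun x => ⁅w, x⁆) (fun x y => h.inv x w y) f
    hf, ← Finset.sum_neg_distrib]
  refine Finset.sum_congr rfl fun i _ => ?_
  have := hf.smul_right (-1) (e i) ⁅e i, w⁆
  rw [neg_one_smul, neg_one_smul, lie_skew] at this
  exact this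

/-- `∑ [eᵢ, w] ⊗ [eᵢ, z]` evaluated against the form. -/
theorem sum_form_lie_lie (h : IsCasimirFrame B e) (w z : g) :
    ∑ i, B ⁅e i, w⁆ ⁅e i, z⁆ = B w z := by
  simp only [h.inv_left, Finset.sum_neg_distrib, ← map_sum, h.casimir, map_neg, neg_neg]

theorem sum_lie_lie_self (h : IsCasimirFrame B e) (x : g) : ∑ i, ⁅⁅x, e i⁆, e i⁆ = -x := by
  rw [← h.casimir x]
  refine Finset.sum_congr rfl fun i _ => ?_
  rw [← lie_skew, ← lie_skew x, lie_neg, neg_neg]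

/-- A skew endomorphism that is trace-orthogonal to `ad` is also trace-orthogonal to all products
of two adjoint endomorphisms. -/
theorem sum_form_lie_lie_eq_zero (h : IsCasimirFrame B e) {D : g →ₗ[ℝ] g}
    (hD : ∀ x y, B (D x) y = -B x (D y)) (hm : ∀ w : g, ∑ i, B (D (e i)) ⁅w, e i⁆ = 0) (w v : g) :
    ∑ i, B (D (e i)) ⁅w, ⁅v, e i⁆⁆ = 0 := by
  have h1 : ∑ i, B (D (e i)) ⁅w, ⁅v, e i⁆⁆ - ∑ i, B (D (e i)) ⁅v, ⁅w, e i⁆⁆ = 0 := by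
    rw [← hm ⁅w, v⁆, ← Finset.sum_sub_distrib]
    refine Finset.sum_congr rfl fun i _ => ?_
    rw [← map_sub, lie_lie]
  have h2 : ∑ i, B (D (e i)) ⁅w, ⁅v, e i⁆⁆ = -∑ i, B (D (e i)) ⁅v, ⁅w, e i⁆⁆ := by
    have := h.sum_adjoint (P := D) (Q := fun x => -D x) (by simp [hD])
      (fun x y => B ⁅v, ⁅w, x⁆⁆ y) (by constructor <;> simp)
    simp only [map_neg, Finset.sum_neg_distrib] at this
    rw [Finset.sum_congr rfl fun i _ => h.symm (D (e i)) ⁅v, ⁅w, e i⁆⁆, ← this]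
    refine Finset.sum_congr rfl fun i _ => ?_
    rw [h.inv_left, h.inv_left, neg_neg]
  linarith

theorem sum_lie_eq_zero (h : IsCasimirFrame B e) {D : g →ₗ[ℝ] g}
    (hm : ∀ w : g, ∑ i, B (D (e i)) ⁅w, e i⁆ = 0) : ∑ i, ⁅D (e i), e i⁆ = 0 := by
  refine h.ext_form fun z => ?_
  simp only [map_sum, LinearMap.sum_apply, map_zero, LinearMap.zero_apply, h.inv]
  have := hm z
  simp only [← lie_skew _ z, map_neg, Finset.sum_neg_distrib] at this ⊢
  simpa using this

theorem sum_lie_lie_right_eq_zero (h : IsCasimirFrame B e) {D : g →ₗ[ℝ] g}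
    (hD : ∀ x y, B (D x) y = -B x (D y)) (hm : ∀ w : g, ∑ i, B (D (e i)) ⁅w, e i⁆ = 0) (v : g) :
    ∑ i, ⁅D (e i), ⁅v, e i⁆⁆ = 0 := by
  refine h.ext_form fun z => ?_
  simp only [map_sum, LinearMap.sum_apply, map_zero, LinearMap.zero_apply, h.inv]
  simp only [← lie_skew _ z, map_neg, Finset.sum_neg_distrib, neg_eq_zero]
  exact h.sum_form_lie_lie_eq_zero hD hm z v

theorem sum_lie_lie_left_eq_zero (h : IsCasimirFrame B e) {D : g →ₗ[ℝ] g}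
    (hD : ∀ x y, B (D x) y = -B x (D y)) (hm : ∀ w : g, ∑ i, B (D (e i)) ⁅w, e i⁆ = 0) (v : g) :
    ∑ i, ⁅⁅D (e i), v⁆, e i⁆ = 0 := by
  have h1 : ∀ i, ⁅⁅D (e i), v⁆, e i⁆ = ⁅D (e i), ⁅v, e i⁆⁆ - ⁅v, ⁅D (e i), e i⁆⁆ := fun i => by
    rw [lie_lie]
  rw [Finset.sum_congr rfl fun i _ => h1 i, Finset.sum_sub_distrib,
    h.sum_lie_lie_right_eq_zero hD hm, ← _root_.lie_sum, h.sum_lie_eq_zero hm]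
  simp

theorem form_self (h : IsCasimirFrame B e) (x : g) : B x x = ∑ i, B x (e i) ^ 2 := by
  rw [← h.sum_expand (fun y => B x y) (B x).isLinear x]
  simp [sq]

theorem form_self_nonneg (h : IsCasimirFrame B e) (x : g) : 0 ≤ B x x := by
  rw [h.form_self]
  positivity

theorem eq_zero_of_form_self (h : IsCasimirFrame B e) {x : g} (hx : B x x = 0) : x = 0 := by
  rw [h.form_self, Finset.sum_eq_zero_iff_of_nonneg fun i _ => sq_nonneg _] at hx
  rw [← h.expand x]
  exact Finset.sum_eq_zero fun i hi => by
    rw [pow_eq_zero_iff two_ne_zero |>.mp (hx i hi), zero_smul]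

theorem eq_zero_of_frame (h : IsCasimirFrame B e) (f : g →ₗ[ℝ] V) (hf : ∀ i, f (e i) = 0) :
    f = 0 := by
  ext x
  rw [← h.sum_expand f f.isLinear x]
  simp [hf]

/-- The Casimir tensor is reproduced by `∑ [eᵢ, eⱼ] ⊗ [eᵢ, eⱼ]`. -/
theorem sum_sum_lie_lie (h : IsCasimirFrame B e) (f : g → g → V)
    (hf : IsBilinearMap ℝ f) :
    ∑ i, ∑ j, f ⁅e i, e j⁆ ⁅e i, e j⁆ = ∑ j, f (e j) (e j) := by
  have h1 : ∀ i, ∑ j, f ⁅e i, e j⁆ ⁅e i, e j⁆ = ∑ j, f (e j) (-⁅e i, ⁅e i, e j⁆⁆) := fun i =>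
    h.sum_adjoint (P := fun x => ⁅e i, x⁆) (Q := fun x => -⁅e i, x⁆)
      (fun x y => by rw [h.inv_left, map_neg]) (fun x y => f x ⁅e i, y⁆)
      ⟨fun x y z => hf.add_left _ _ _, fun c x z => hf.smul_left _ _ _,
        fun x y z => by rw [lie_add, hf.add_right],
        fun c x z => by rw [lie_smul, hf.smul_right]⟩ |>.trans
      (Finset.sum_congr rfl fun j _ => by rw [lie_neg])
  rw [Finset.sum_congr rfl fun i _ => h1 i, Finset.sum_comm]
  refine Finset.sum_congr rfl fun j _ => ?_
  have h2 := congrArg (hf.toLinearMap (e j)) (h.casimir (e j))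
  rw [map_sum, map_neg] at h2
  have hneg : ∀ x, f (e j) (-x) = -f (e j) x := (hf.toLinearMap (e j)).map_neg
  simp only [hneg, Finset.sum_neg_distrib]
  exact neg_eq_iff_eq_neg.mpr h2

/-- Pair symmetry of a curvature tensor `(x, y) ↦ ad (T x y)`. -/
theorem pair_symm (h : IsCasimirFrame B e) {T : g →ₗ[ℝ] g →ₗ[ℝ] g} (alt : ∀ x y, T x y = -T y x)
    (cyc : ∀ x y z : g, ⁅T x y, z⁆ + ⁅T y z, x⁆ + ⁅T z x, y⁆ = 0) (x y z w : g) :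
    B (T x y) ⁅z, w⁆ = B (T z w) ⁅x, y⁆ := by
  have c : ∀ x y z w : g, B (T x y) ⁅z, w⁆ + B (T y z) ⁅x, w⁆ + B (T z x) ⁅y, w⁆ = 0 :=
    fun x y z w => by
      have := congrArg (fun u => B u w) (cyc x y z)
      simpa only [map_add, LinearMap.add_apply, h.inv, map_zero, LinearMap.zero_apply] using this
  have s : ∀ x y z w : g, B (T x y) ⁅z, w⁆ = -B (T y x) ⁅z, w⁆ := fun x y z w => by
    rw [alt x y, map_neg, LinearMap.neg_apply]
  have s' : ∀ x y z w : g, B (T x y) ⁅z, w⁆ = -B (T x y) ⁅w, z⁆ := fun x y z w => by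
    rw [← lie_skew, map_neg]
  linarith [c x y z w, c y z w x, c z w x y, c w x y z, s z x y w, s w y z x, s x z w y,
    s y w x z, s' x y w z, s' y z x w, s' z w y x, s' w x z y, s' x z y w, s' y w z x]

/-- A curvature tensor with values in the adjoint endomorphisms factors through the bracket. -/
theorem exists_eq_lie (h : IsCasimirFrame B e) {T : g →ₗ[ℝ] g →ₗ[ℝ] g}
    (alt : ∀ x y, T x y = -T y x)
    (cyc : ∀ x y z : g, ⁅T x y, z⁆ + ⁅T y z, x⁆ + ⁅T z x, y⁆ = 0) :
    ∃ A : g →ₗ[ℝ] g, (∀ x y, B (A x) y = B x (A y)) ∧ ∀ x y, T x y = A ⁅x, y⁆ := by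
  let A : g →ₗ[ℝ] g := -∑ i, T (e i) ∘ₗ (ad ℝ g (e i) : g →ₗ[ℝ] g)
  have hA : ∀ w, A w = -∑ i, T (e i) ⁅e i, w⁆ := fun w => by simp [A]
  have h1 : ∀ x y v, B (T x y) v = B (A v) ⁅x, y⁆ := fun x y v => by
    have := congrArg (B (T x y)) (h.casimir v)
    simp only [map_sum, map_neg, h.pair_symm alt cyc x y] at this
    simp only [hA, map_neg, map_sum, LinearMap.neg_apply, LinearMap.sum_apply, this, neg_neg]
  have h2 : ∀ v w, B (A v) w = B v (A w) := fun v w => by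
    rw [h.symm v, hA w]
    have := congrArg (B (A v)) (h.casimir w)
    simp only [map_sum, map_neg, ← h1] at this
    simp only [map_neg, map_sum, LinearMap.neg_apply, LinearMap.sum_apply, this, neg_neg]
  exact ⟨A, h2, fun x y => h.ext_form fun v => by rw [h1, h2, h.symm]⟩

theorem sum_form_of_cyclic (h : IsCasimirFrame B e) {A : g →ₗ[ℝ] g}
    (cyc : ∀ x y z : g, ⁅A ⁅x, y⁆, z⁆ + ⁅A ⁅y, z⁆, x⁆ + ⁅A ⁅z, x⁆, y⁆ = 0) (z v w : g) :
    2 * ∑ i, B (A ⁅e i, z⁆) ⁅e i, ⁅w, v⁆⁆ = B z (⁅A w, v⁆ + ⁅w, A v⁆) := by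
  have h1 : ∀ w v, 2 * ∑ i, B (A ⁅e i, z⁆) ⁅⁅e i, w⁆, v⁆ = B z ⁅A w, v⁆ := fun w v => by
    have h2 := Finset.sum_eq_zero fun i (_ : i ∈ Finset.univ) => cyc (e i) ⁅e i, w⁆ z
    rw [Finset.sum_add_distrib, Finset.sum_add_distrib, h.sum_lie w (fun x y => ⁅A ⁅x, z⁆, y⁆)
        (by constructor <;> simp),
      ← _root_.sum_lie, ← map_sum, h.casimir] at h2
    simp only [← lie_skew z, map_neg, neg_lie, Finset.sum_neg_distrib] at h2
    have h3 := congrArg (fun u => B u v) h2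
    simp only [map_add, map_neg, map_sum, LinearMap.add_apply, LinearMap.neg_apply,
      LinearMap.sum_apply, h.inv, map_zero, LinearMap.zero_apply] at h3
    have h4 : B (A w) ⁅z, v⁆ = -B z ⁅A w, v⁆ := by rw [← h.inv, h.inv_left]
    linarith
  have h2 : ∀ i, B (A ⁅e i, z⁆) ⁅e i, ⁅w, v⁆⁆
      = B (A ⁅e i, z⁆) ⁅⁅e i, w⁆, v⁆ - B (A ⁅e i, z⁆) ⁅⁅e i, v⁆, w⁆ := fun i => by
    rw [← map_sub, leibniz_lie, ← lie_skew w ⁅e i, v⁆, sub_eq_add_neg]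
  rw [Finset.sum_congr rfl fun i _ => h2 i, Finset.sum_sub_distrib, mul_sub, h1, h1, map_add,
    ← lie_skew w, map_neg, sub_eq_add_neg]

theorem quadratic_of_cyclic (h : IsCasimirFrame B e) {A : g →ₗ[ℝ] g}
    (hA : ∀ x y, B (A x) y = B x (A y))
    (cyc : ∀ x y z : g, ⁅A ⁅x, y⁆, z⁆ + ⁅A ⁅y, z⁆, x⁆ + ⁅A ⁅z, x⁆, y⁆ = 0) {r : ℝ}
    (hr : ∀ x y, ∑ i, B (A ⁅e i, x⁆) ⁅e i, y⁆ = r * B (A x) y) (x y : g) :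
    (2 * r ^ 2 - r - 1) * B (A x) y = 0 := by
  have h1 : ∑ j, B ⁅e j, x⁆ ⁅A (e j), y⁆ = r * B (A y) x := by
    have h2 : ∀ j, B ⁅e j, x⁆ ⁅A (e j), y⁆ = B (A ⁅y, ⁅e j, x⁆⁆) (e j) := fun j => by
      rw [hA, h.inv_left y, ← lie_skew y, map_neg, neg_neg]
    rw [Finset.sum_congr rfl fun j _ => h2 j,
      h.sum_lie x (fun u v => B (A ⁅y, u⁆) v) (by constructor <;> simp), ← hr,
      ← Finset.sum_neg_distrib]
    refine Finset.sum_congr rfl fun j _ => ?_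
    rw [← lie_skew y, map_neg, map_neg, LinearMap.neg_apply, neg_neg]
  have h2 := Finset.sum_congr (rfl : (Finset.univ : Finset ι) = _)
    fun j _ => h.sum_form_of_cyclic cyc ⁅e j, x⁆ y (e j)
  simp only [hr, map_add, Finset.sum_add_distrib, h1, h.sum_form_lie_lie, ← Finset.mul_sum] at h2
  have h3 : B (A y) x = B (A x) y := by rw [hA, h.symm]
  have h4 : B x (A y) = B (A x) y := (hA x y).symm
  rw [h3, h4] at h2
  linarith

/-- A symmetric endomorphism fixed by `A ↦ -∑ ad(eᵢ) A ad(eᵢ)` commutes with `ad`. -/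
theorem map_lie_of_fixed (h : IsCasimirFrame B e) {A : g →ₗ[ℝ] g}
    (hr : ∀ x y, ∑ i, B (A ⁅e i, x⁆) ⁅e i, y⁆ = B (A x) y) (x y : g) :
    ⁅x, A y⁆ = A ⁅x, y⁆ := by
  have h1 : ∀ i j, B (⁅e i, A (e j)⁆ - A ⁅e i, e j⁆) (⁅e i, A (e j)⁆ - A ⁅e i, e j⁆)
      = B ⁅e i, A (e j)⁆ ⁅e i, A (e j)⁆ - 2 * B (A ⁅e i, e j⁆) ⁅e i, A (e j)⁆
        + B (A ⁅e i, e j⁆) (A ⁅e i, e j⁆) := fun i j => by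
    simp only [map_sub, LinearMap.sub_apply, h.symm ⁅e i, A (e j)⁆ (A ⁅e i, e j⁆)]
    ring
  have h2 : ∑ j, ∑ i, B (⁅e i, A (e j)⁆ - A ⁅e i, e j⁆) (⁅e i, A (e j)⁆ - A ⁅e i, e j⁆) = 0 := by
    simp only [h1, Finset.sum_add_distrib, Finset.sum_sub_distrib, ← Finset.mul_sum, hr,
      h.sum_form_lie_lie]
    rw [Finset.sum_comm (f := fun j i => B (A ⁅e i, e j⁆) (A ⁅e i, e j⁆)),
      h.sum_sum_lie_lie (fun u v => B (A u) (A v)) (by constructor <;> simp)]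
    ring
  have h3 : ∀ i j, ⁅e i, A (e j)⁆ - A ⁅e i, e j⁆ = 0 := fun i j => by
    rw [Finset.sum_eq_zero_iff_of_nonneg fun j _ => Finset.sum_nonneg fun i _ =>
      h.form_self_nonneg _] at h2
    have h4 := h2 j (Finset.mem_univ j)
    rw [Finset.sum_eq_zero_iff_of_nonneg fun i _ => h.form_self_nonneg _] at h4
    exact h.eq_zero_of_form_self (h4 i (Finset.mem_univ i))
  have h4 : ∀ i, (ad ℝ g (e i) : g →ₗ[ℝ] g) ∘ₗ A - A ∘ₗ (ad ℝ g (e i) : g →ₗ[ℝ] g) = 0 :=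
    fun i => h.eq_zero_of_frame _ fun j => by simpa using h3 i j
  have h5 := h.eq_zero_of_frame
    (-(ad ℝ g (A y) : g →ₗ[ℝ] g) + A ∘ₗ (ad ℝ g y : g →ₗ[ℝ] g)) fun i => by
      have := LinearMap.congr_fun (h4 i) y
      simp only [LinearMap.sub_apply, LinearMap.comp_apply, ad_apply, LinearMap.zero_apply] at this
      simp only [LinearMap.add_apply, LinearMap.neg_apply, LinearMap.comp_apply, ad_apply, lie_skew]
      rw [← lie_skew y, map_neg, ← sub_eq_add_neg, this]
  have := LinearMap.congr_fun h5 x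
  simp only [LinearMap.add_apply, LinearMap.neg_apply, LinearMap.comp_apply, ad_apply, lie_skew,
    LinearMap.zero_apply] at this
  rw [← lie_skew y, map_neg, ← sub_eq_add_neg] at this
  exact sub_eq_zero.mp this

end IsCasimirFrame

/-- A pair `(K, Φ)` satisfying the linearised Bianchi identity over a Casimir frame, with each
`K z` skew and trace-orthogonal to the adjoint endomorphisms. -/
structure IsBianchiPair {g ι : Type*} [LieRing g] [LieAlgebra ℝ g] [Fintype ι]
    (B : g →ₗ[ℝ] g →ₗ[ℝ] ℝ) (e : ι → g) (K Φ : g →ₗ[ℝ] g →ₗ[ℝ] g) : Prop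
    extends IsCasimirFrame B e where
  skew : ∀ z x y, B (K z x) y = -B x (K z y)
  orth : ∀ z w : g, ∑ i, B (K z (e i)) ⁅w, e i⁆ = 0
  alt : ∀ x y, Φ x y = -Φ y x
  cyclic : ∀ x y z, B (Φ x y) z + B (Φ y z) x + B (Φ z x) y = 0
  bianchi : ∀ x y z a : g,
    (⁅⁅x, y⁆, K z a⁆ - K z ⁅⁅x, y⁆, a⁆ + ⁅⁅K x y - K y x, z⁆, a⁆
      + (B (Φ x y) a • z - B z a • Φ x y))
    + (⁅⁅y, z⁆, K x a⁆ - K x ⁅⁅y, z⁆, a⁆ + ⁅⁅K y z - K z y, x⁆, a⁆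
      + (B (Φ y z) a • x - B x a • Φ y z))
    + (⁅⁅z, x⁆, K y a⁆ - K y ⁅⁅z, x⁆, a⁆ + ⁅⁅K z x - K x z, y⁆, a⁆
      + (B (Φ z x) a • y - B y a • Φ z x)) = 0

namespace IsBianchiPair

variable {g ι : Type*} [LieRing g] [LieAlgebra ℝ g] [Fintype ι]
  {B : g →ₗ[ℝ] g →ₗ[ℝ] ℝ} {e : ι → g} {K Φ : g →ₗ[ℝ] g →ₗ[ℝ] g}

theorem sum_lie_lie_left (h : IsBianchiPair B e K Φ) (z v : g) :
    ∑ i, ⁅⁅K z (e i), v⁆, e i⁆ = 0 :=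
  h.toIsCasimirFrame.sum_lie_lie_left_eq_zero (h.skew z) (h.orth z) v

theorem sum_lie_lie_right (h : IsBianchiPair B e K Φ) (z v : g) :
    ∑ i, ⁅K z (e i), ⁅v, e i⁆⁆ = 0 :=
  h.toIsCasimirFrame.sum_lie_lie_right_eq_zero (h.skew z) (h.orth z) v

theorem sum_lie_lie_right' (h : IsBianchiPair B e K Φ) (z v : g) :
    ∑ i, ⁅K z (e i), ⁅e i, v⁆⁆ = 0 := by
  simp only [← lie_skew _ v, lie_neg, Finset.sum_neg_distrib, h.sum_lie_lie_right, neg_zero]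

theorem sum_form_lie_lie (h : IsBianchiPair B e K Φ) (z v w : g) :
    ∑ i, B (K z (e i)) ⁅w, ⁅v, e i⁆⁆ = 0 :=
  h.toIsCasimirFrame.sum_form_lie_lie_eq_zero (h.skew z) (h.orth z) w v

theorem sum_lie_bianchi_term (h : IsBianchiPair B e K Φ) (w u p z : g) :
    ∑ i, ⁅⁅w, K z (e i)⁆ - K z ⁅w, e i⁆ + ⁅⁅u, z⁆, e i⁆ + (B p (e i) • z - B z (e i) • p), e i⁆
      = -⁅u + (2 : ℝ) • p, z⁆ := by
  have hf := h.toIsCasimirFrame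
  have h1 : ∑ i, ⁅⁅w, K z (e i)⁆, e i⁆ = 0 := by
    simp only [← lie_skew w, neg_lie, Finset.sum_neg_distrib, h.sum_lie_lie_left, neg_zero]
  have h2 : ∑ i, ⁅K z ⁅w, e i⁆, e i⁆ = 0 := by
    have := hf.sum_lie w (fun x y => ⁅K z x, y⁆) (by constructor <;> simp)
    simp only [h.sum_lie_lie_right', neg_zero] at this
    simp only [← lie_skew w, map_neg, neg_lie, Finset.sum_neg_distrib, this, neg_zero]
  have h4 : ∀ a b : g, ∑ i, B a (e i) • ⁅b, e i⁆ = ⁅b, a⁆ := fun a b => by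
    rw [← congrArg (fun x => ⁅b, x⁆) (hf.expand a), _root_.lie_sum]
    simp
  simp only [add_lie, sub_lie, Finset.sum_add_distrib, Finset.sum_sub_distrib, h1, h2, h4,
    smul_lie, hf.sum_lie_lie_self]
  rw [← lie_skew z p]
  module

/-- The projection of the Bianchi identity to the adjoint endomorphisms. -/
theorem cyclic_lie (h : IsBianchiPair B e K Φ) (x y z : g) :
    ⁅K x y - K y x + (2 : ℝ) • Φ x y, z⁆ + ⁅K y z - K z y + (2 : ℝ) • Φ y z, x⁆
      + ⁅K z x - K x z + (2 : ℝ) • Φ z x, y⁆ = 0 := by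
  have h0 : -⁅K x y - K y x + (2 : ℝ) • Φ x y, z⁆ + -⁅K y z - K z y + (2 : ℝ) • Φ y z, x⁆
      + -⁅K z x - K x z + (2 : ℝ) • Φ z x, y⁆ = 0 := by
    rw [← h.sum_lie_bianchi_term ⁅x, y⁆, ← h.sum_lie_bianchi_term ⁅y, z⁆,
      ← h.sum_lie_bianchi_term ⁅z, x⁆, ← Finset.sum_add_distrib, ← Finset.sum_add_distrib]
    refine Finset.sum_eq_zero fun i _ => ?_
    rw [← add_lie, ← add_lie, h.bianchi, zero_lie]
  rw [← neg_eq_zero, ← h0]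
  abel

theorem sum_bianchi_term_fst (h : IsBianchiPair B e K Φ) (w u p : g) :
    ∑ i, (⁅w, K (e i) (e i)⁆ - K (e i) ⁅w, e i⁆ + ⁅⁅u, e i⁆, e i⁆
      + (B p (e i) • e i - B (e i) (e i) • p))
      = ⁅w, ∑ i, K (e i) (e i)⁆ - ∑ i, K (e i) ⁅w, e i⁆ - u + (1 - Fintype.card ι : ℝ) • p := by
  simp only [Finset.sum_add_distrib, Finset.sum_sub_distrib, h.expand, h.norm_sq,
    h.toIsCasimirFrame.sum_lie_lie_self, ← _root_.lie_sum, one_smul, Finset.sum_const,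
    Finset.card_univ, ← Nat.cast_smul_eq_nsmul ℝ]
  module

theorem sum_bianchi_term_snd (h : IsBianchiPair B e K Φ) (x y : g) :
    ∑ i, (⁅⁅y, e i⁆, K x (e i)⁆ - K x ⁅⁅y, e i⁆, e i⁆ + ⁅⁅K y (e i) - K (e i) y, x⁆, e i⁆
      + (B (Φ y (e i)) (e i) • x - B x (e i) • Φ y (e i)))
      = K x y - ∑ i, ⁅⁅K (e i) y, x⁆, e i⁆ + (∑ i, B (Φ y (e i)) (e i)) • x - Φ y x := by
  have h1 : ∑ i, ⁅⁅y, e i⁆, K x (e i)⁆ = 0 := by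
    simp only [← lie_skew ⁅y, _⁆, Finset.sum_neg_distrib, h.sum_lie_lie_right, neg_zero]
  have h2 : ∑ i, B x (e i) • Φ y (e i) = Φ y x :=
    h.toIsCasimirFrame.sum_expand _ (Φ y).isLinear x
  simp only [Finset.sum_add_distrib, Finset.sum_sub_distrib, sub_lie, ← Finset.sum_smul,
    h1, h2, ← map_sum, h.toIsCasimirFrame.sum_lie_lie_self, h.sum_lie_lie_left, map_neg]
  module

/-- The Ricci-type contraction of the Bianchi identity. -/
theorem contracted_bianchi (h : IsBianchiPair B e K Φ) (x y : g) :
    ⁅⁅x, y⁆, ∑ i, K (e i) (e i)⁆ - ∑ i, K (e i) ⁅⁅x, y⁆, e i⁆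
      + (3 - Fintype.card ι : ℝ) • Φ x y
      + ∑ i, ⁅⁅K (e i) x, y⁆, e i⁆ - ∑ i, ⁅⁅K (e i) y, x⁆, e i⁆
      + (∑ i, B (Φ y (e i)) (e i)) • x - (∑ i, B (Φ x (e i)) (e i)) • y = 0 := by
  have h0 := Finset.sum_eq_zero fun i (_ : i ∈ Finset.univ) => h.bianchi x y (e i) (e i)
  rw [Finset.sum_add_distrib, Finset.sum_add_distrib, h.sum_bianchi_term_fst,
    h.sum_bianchi_term_snd] at h0
  have h1 : ∀ i, ⁅⁅e i, x⁆, K y (e i)⁆ - K y ⁅⁅e i, x⁆, e i⁆ + ⁅⁅K (e i) x - K x (e i), y⁆, e i⁆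
      + (B (Φ (e i) x) (e i) • y - B y (e i) • Φ (e i) x)
      = -(⁅⁅x, e i⁆, K y (e i)⁆ - K y ⁅⁅x, e i⁆, e i⁆ + ⁅⁅K x (e i) - K (e i) x, y⁆, e i⁆
      + (B (Φ x (e i)) (e i) • y - B y (e i) • Φ x (e i))) := fun i => by
    rw [← lie_skew x, h.alt (e i) x]
    simp only [neg_lie, map_neg, sub_lie, LinearMap.neg_apply]
    module
  rw [Finset.sum_congr rfl fun i _ => h1 i, Finset.sum_neg_distrib, h.sum_bianchi_term_snd,
    h.alt y x] at h0
  rw [← h0]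
  module

end IsBianchiPair

namespace IsBianchiPair

variable {g ι : Type*} [LieRing g] [LieAlgebra ℝ g] [Fintype ι]
  {B : g →ₗ[ℝ] g →ₗ[ℝ] ℝ} {e : ι → g} {K Φ : g →ₗ[ℝ] g →ₗ[ℝ] g}

theorem trace_eq_zero (h : IsBianchiPair B e K Φ) (hn : 2 < Fintype.card ι) (x : g) :
    ∑ i, B (Φ x (e i)) (e i) = 0 := by
  have hf := h.toIsCasimirFrame
  have h0 := Finset.sum_eq_zero fun j (_ : j ∈ Finset.univ) =>
    congrArg (fun u => B u (e j)) (h.contracted_bianchi x (e j)) |>.trans (by simp)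
  simp only [map_add, map_sub, map_sum, map_smul, LinearMap.add_apply, LinearMap.sub_apply,
    LinearMap.sum_apply, LinearMap.smul_apply, Finset.sum_add_distrib, Finset.sum_sub_distrib,
    smul_eq_mul, ← Finset.mul_sum, h.norm_sq] at h0
  have h1 : ∀ w, ∑ j, B ⁅⁅x, e j⁆, w⁆ (e j) = B x w := fun w => by
    rw [← hf.sum_form_lie_lie]
    refine Finset.sum_congr rfl fun j _ => ?_
    rw [h.inv, ← lie_skew x, ← lie_skew w, map_neg, map_neg, LinearMap.neg_apply, neg_neg]
  have h2 : ∑ j, ∑ i, B (K (e i) ⁅⁅x, e j⁆, e i⁆) (e j) = 0 := by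
    rw [Finset.sum_comm]
    refine Finset.sum_eq_zero fun i _ => ?_
    rw [← h.sum_form_lie_lie (e i) x (e i)]
    refine Finset.sum_congr rfl fun j _ => ?_
    rw [h.skew, h.symm, ← lie_skew, map_neg, neg_neg]
  have h3 : ∑ j, ∑ i, B ⁅⁅K (e i) x, e j⁆, e i⁆ (e j) = -B x (∑ i, K (e i) (e i)) := by
    rw [Finset.sum_comm, map_sum, ← Finset.sum_neg_distrib]
    refine Finset.sum_congr rfl fun i _ => ?_
    rw [← h.skew, ← hf.sum_form_lie_lie]
    refine Finset.sum_congr rfl fun j _ => ?_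
    rw [h.inv, ← lie_skew _ (e j), ← lie_skew (e i), map_neg, map_neg, LinearMap.neg_apply,
      neg_neg]
  have h4 : ∑ j, ∑ i, B ⁅⁅K (e i) (e j), x⁆, e i⁆ (e j) = 0 := by
    rw [Finset.sum_comm]
    refine Finset.sum_eq_zero fun i _ => ?_
    rw [← h.sum_form_lie_lie (e i) (e i) x]
    refine Finset.sum_congr rfl fun j _ => ?_
    rw [h.inv, h.inv]
  have h5 : ∑ j, (∑ i, B (Φ (e j) (e i)) (e i)) * B x (e j) = ∑ i, B (Φ x (e i)) (e i) := by
    rw [← hf.sum_expand (fun u => ∑ i, B (Φ u (e i)) (e i)) ⟨fun u v => by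
      simp [Finset.sum_add_distrib], fun c v => by simp [Finset.mul_sum]⟩ x]
    simp [mul_comm]
  simp only [h1, h2, h3, h4, h5, Finset.sum_const, Finset.card_univ, nsmul_eq_mul] at h0
  have hn' : (2 : ℝ) < Fintype.card ι := by exact_mod_cast hn
  have h6 : (4 - 2 * (Fintype.card ι : ℝ)) * ∑ i, B (Φ x (e i)) (e i) = 0 := by linarith
  exact (mul_eq_zero.mp h6).resolve_left (by linarith)

theorem sum_apply_self_eq_zero (h : IsBianchiPair B e K Φ) (hn : 2 < Fintype.card ι)
    {A : g →ₗ[ℝ] g} (hA : ∀ x y, B (A x) y = B x (A y))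
    (hT : ∀ x y, K x y - K y x + (2 : ℝ) • Φ x y = A ⁅x, y⁆) : ∑ i, K (e i) (e i) = 0 := by
  have hf := h.toIsCasimirFrame
  refine hf.ext_form fun x => ?_
  have h1 : ∑ j, B (A ⁅x, e j⁆) (e j) = 0 := by
    have h2 : ∑ j, B ⁅x, A (e j)⁆ (e j) = ∑ j, B ⁅x, e j⁆ (A (e j)) :=
      hf.sum_adjoint hA (fun u v => B ⁅x, u⁆ v) (by constructor <;> simp)
    have h3 : ∀ j, B ⁅x, A (e j)⁆ (e j) = -B (A ⁅x, e j⁆) (e j) := fun j => by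
      rw [hf.inv_left, hA, h.symm]
    simp only [h3, ← hA, Finset.sum_neg_distrib] at h2
    linarith
  have h2 : ∑ j, B (K x (e j)) (e j) = 0 := Finset.sum_eq_zero fun j _ => by
    have := h.skew x (e j) (e j)
    rw [h.symm (e j)] at this
    linarith
  simp only [← hT, map_add, map_sub, map_smul, LinearMap.add_apply, LinearMap.sub_apply,
    LinearMap.smul_apply, smul_eq_mul, Finset.sum_add_distrib, Finset.sum_sub_distrib,
    ← Finset.mul_sum, h.trace_eq_zero hn, h2] at h1
  simp only [map_zero, LinearMap.zero_apply, map_sum, LinearMap.sum_apply]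
  simp only [h.skew _ x, h.symm x, Finset.sum_neg_distrib] at h1
  linarith

theorem sum_apply_lie (h : IsBianchiPair B e K Φ) (hn : 2 < Fintype.card ι)
    {A : g →ₗ[ℝ] g} (hA : ∀ x y, B (A x) y = B x (A y))
    (hT : ∀ x y, K x y - K y x + (2 : ℝ) • Φ x y = A ⁅x, y⁆) (v : g) :
    ∑ i, K (e i) ⁅e i, v⁆ = (3 - Fintype.card ι : ℝ) • ∑ i, Φ (e i) ⁅e i, v⁆ := by
  have hf := h.toIsCasimirFrame
  have h0 := Finset.sum_eq_zero fun a (_ : a ∈ Finset.univ) =>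
    h.contracted_bianchi (e a) ⁅e a, v⁆
  simp only [h.trace_eq_zero hn, h.sum_apply_self_eq_zero hn hA hT, lie_zero, zero_smul, sub_zero,
    add_zero, zero_sub, Finset.sum_add_distrib, Finset.sum_sub_distrib, Finset.sum_neg_distrib,
    ← Finset.smul_sum] at h0
  have h1 : ∑ a, ∑ i, K (e i) ⁅⁅e a, ⁅e a, v⁆⁆, e i⁆ = ∑ i, K (e i) ⁅e i, v⁆ := by
    rw [Finset.sum_comm]
    simp only [← map_sum, ← _root_.sum_lie, h.casimir, neg_lie, lie_skew]
  have h2 : ∑ a, ∑ i, ⁅⁅K (e i) (e a), ⁅e a, v⁆⁆, e i⁆ = 0 := by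
    rw [Finset.sum_comm]
    simp only [← _root_.sum_lie, h.sum_lie_lie_right', zero_lie, Finset.sum_const_zero]
  have h3 : ∑ a, ∑ i, ⁅⁅K (e i) ⁅e a, v⁆, e a⁆, e i⁆ = 0 := by
    rw [Finset.sum_comm]
    simp only [← _root_.sum_lie]
    refine Finset.sum_eq_zero fun i _ => ?_
    rw [hf.sum_lie v (fun x y => ⁅K (e i) x, y⁆) (by constructor <;> simp),
      h.sum_lie_lie_right', neg_zero, zero_lie]
  rw [h1, h2, h3, add_zero, sub_zero, neg_add_eq_zero] at h0
  exact h0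

theorem two_mul_sum_form (h : IsBianchiPair B e K Φ) (z v : g) :
    2 * ∑ i, B (Φ (e i) z) ⁅e i, v⁆ = B (∑ i, Φ (e i) ⁅e i, v⁆) z := by
  have hf := h.toIsCasimirFrame
  have h0 := Finset.sum_eq_zero fun a (_ : a ∈ Finset.univ) => h.cyclic (e a) z ⁅e a, v⁆
  rw [Finset.sum_add_distrib, Finset.sum_add_distrib, hf.sum_lie v (fun x y => B (Φ z x) y)
      (by constructor <;> simp)] at h0
  simp only [h.alt z, h.alt ⁅_, _⁆, map_neg, LinearMap.neg_apply, Finset.sum_neg_distrib,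
    neg_neg] at h0
  rw [map_sum, LinearMap.sum_apply]
  linarith

theorem map_eq_smul (h : IsBianchiPair B e K Φ) (hn : 2 < Fintype.card ι)
    {A : g →ₗ[ℝ] g} (hA : ∀ x y, B (A x) y = B x (A y))
    (hT : ∀ x y, K x y - K y x + (2 : ℝ) • Φ x y = A ⁅x, y⁆) (v : g) :
    A v = (2 * (Fintype.card ι - 4) : ℝ) • ∑ i, Φ (e i) ⁅e i, v⁆ := by
  have hf := h.toIsCasimirFrame
  have h0 := Finset.sum_congr (rfl : (Finset.univ : Finset ι) = _) fun i _ => hT (e i) ⁅e i, v⁆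
  rw [← map_sum, h.casimir, Finset.sum_add_distrib, Finset.sum_sub_distrib,
    hf.sum_lie v (fun x y => K x y) (by constructor <;> simp),
    ← Finset.smul_sum, h.sum_apply_lie hn hA hT, map_neg] at h0
  rw [← neg_neg (A v), ← h0]
  module

theorem sum_form_map (h : IsBianchiPair B e K Φ) (hn : 2 < Fintype.card ι)
    {A : g →ₗ[ℝ] g} (hA : ∀ x y, B (A x) y = B x (A y))
    (hT : ∀ x y, K x y - K y x + (2 : ℝ) • Φ x y = A ⁅x, y⁆) (z v : g) :
    ∑ i, B (A ⁅e i, z⁆) ⁅e i, v⁆ = (Fintype.card ι - 2 : ℝ) * B (∑ i, Φ (e i) ⁅e i, v⁆) z := by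
  have h1 : ∑ i, B (K (e i) z) ⁅e i, v⁆ = -B z (∑ i, K (e i) ⁅e i, v⁆) := by
    rw [map_sum, ← Finset.sum_neg_distrib]
    exact Finset.sum_congr rfl fun i _ => h.skew _ _ _
  have h2 : ∑ i, B (K z (e i)) ⁅e i, v⁆ = 0 := by
    simp only [← lie_skew _ v, map_neg, Finset.sum_neg_distrib, h.orth, neg_zero]
  simp only [← hT, map_add, map_sub, map_smul, LinearMap.add_apply, LinearMap.sub_apply,
    LinearMap.smul_apply, smul_eq_mul, Finset.sum_add_distrib, Finset.sum_sub_distrib,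
    ← Finset.mul_sum, h.two_mul_sum_form, h1, h2, h.sum_apply_lie hn hA hT]
  rw [h.symm z]
  ring

theorem eq_zero_of_card_eq_six (h : IsBianchiPair B e K Φ) (hn : Fintype.card ι = 6)
    {A : g →ₗ[ℝ] g} (hA : ∀ x y, B (A x) y = B x (A y))
    (hT : ∀ x y, K x y - K y x + (2 : ℝ) • Φ x y = A ⁅x, y⁆) : A = 0 := by
  have hf := h.toIsCasimirFrame
  have hφ : ∀ v, A v = (4 : ℝ) • ∑ i, Φ (e i) ⁅e i, v⁆ := fun v => by
    rw [h.map_eq_smul (by omega) hA hT, hn]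
    norm_num
  have hk : ∀ v, A v = (-4 / 3 : ℝ) • ∑ i, K (e i) ⁅e i, v⁆ := fun v => by
    rw [hφ, h.sum_apply_lie (by omega) hA hT, hn, smul_smul]
    norm_num
  have hcomm : ∀ x y : g, ⁅x, A y⁆ = A ⁅x, y⁆ := hf.map_lie_of_fixed fun x y => by
    rw [h.sum_form_map (by omega) hA hT, hA x y, hφ y, hn, h.symm x, map_smul,
      LinearMap.smul_apply, smul_eq_mul]
    norm_num
  have h1 : ∀ i, ∑ j, B (K (e i) ⁅e i, e j⁆) (A (e j)) = 0 := fun i => by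
    rw [← hf.sum_adjoint hA (fun u v => B (K (e i) ⁅e i, u⁆) v) (by constructor <;> simp),
      ← neg_eq_zero,
      ← h.orth (e i) (A (e i)), ← Finset.sum_neg_distrib]
    refine Finset.sum_congr rfl fun j _ => ?_
    rw [h.skew, neg_neg, h.symm, hcomm, ← lie_skew, map_neg, ← hcomm, lie_skew]
  have h2 : ∑ j, B (A (e j)) (A (e j)) = 0 := by
    have : ∀ j u, B (A (e j)) u = -4 / 3 * ∑ i, B (K (e i) ⁅e i, e j⁆) u :=
      fun j u => by
        rw [hk (e j), map_smul, LinearMap.smul_apply, map_sum, LinearMap.sum_apply, smul_eq_mul]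
    rw [Finset.sum_congr rfl fun j _ => this j (A (e j)), ← Finset.mul_sum, Finset.sum_comm,
      Finset.sum_eq_zero fun i _ => h1 i, mul_zero]
  rw [Finset.sum_eq_zero_iff_of_nonneg fun j _ => hf.form_self_nonneg _] at h2
  exact hf.eq_zero_of_frame A fun j => hf.eq_zero_of_form_self (h2 j (Finset.mem_univ j))

/-- The `ad`-valued part of the Bianchi identity forces the torsion-like expression to vanish. -/
theorem torsion_eq_zero (h : IsBianchiPair B e K Φ) (hn : 4 < Fintype.card ι) (x y : g) :
    K x y - K y x + (2 : ℝ) • Φ x y = 0 := by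
  have hf := h.toIsCasimirFrame
  obtain ⟨A, hA, hT⟩ := hf.exists_eq_lie (T := K - K.flip + (2 : ℝ) • Φ)
    (fun x y => by
      simp only [LinearMap.add_apply, LinearMap.sub_apply, LinearMap.smul_apply,
        LinearMap.flip_apply, h.alt x y]
      module) (fun x y z => by simpa using h.cyclic_lie x y z)
  replace hT : ∀ x y, K x y - K y x + (2 : ℝ) • Φ x y = A ⁅x, y⁆ := fun x y => by
    simpa using hT x y
  suffices A = 0 by rw [hT, this, LinearMap.zero_apply]
  by_cases h6 : Fintype.card ι = 6
  · exact h.eq_zero_of_card_eq_six h6 hA hT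
  have hn' : (4 : ℝ) < Fintype.card ι := by exact_mod_cast hn
  have h6' : (Fintype.card ι : ℝ) ≠ 6 := by exact_mod_cast h6
  generalize hn_eq : (Fintype.card ι : ℝ) = n at hn' h6'
  have h4 : n - 4 ≠ 0 := by linarith
  have hr : ∀ x y, ∑ i, B (A ⁅e i, x⁆) ⁅e i, y⁆ = (n - 2) / (2 * (n - 4)) * B (A x) y :=
    fun x y => by
      rw [h.sum_form_map (by omega) hA hT, hA x y, h.map_eq_smul (by omega) hA hT y, h.symm x,
        map_smul, LinearMap.smul_apply, smul_eq_mul, hn_eq]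
      field_simp
  ext x
  refine hf.ext_form fun y => ?_
  have := hf.quadratic_of_cyclic hA (fun x y z => by simpa only [hT] using h.cyclic_lie x y z)
    hr x y
  have h5 : 2 * ((n - 2) / (2 * (n - 4))) ^ 2 - (n - 2) / (2 * (n - 4)) - 1
      = -((n - 3) * (n - 6)) / (n - 4) ^ 2 := by
    field_simp
    ring
  rw [h5] at this
  rw [(mul_eq_zero.mp this).resolve_left, LinearMap.zero_apply, map_zero, LinearMap.zero_apply]
  have : n - 3 ≠ 0 := by linarith
  have : n - 6 ≠ 0 := sub_ne_zero.mpr h6'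
  exact div_ne_zero (neg_ne_zero.mpr (mul_ne_zero ‹_› ‹_›)) (pow_ne_zero 2 h4)

end IsBianchiPair

namespace IsCasimirFrame

variable {g ι : Type*} [LieRing g] [LieAlgebra ℝ g] [Fintype ι]
  {B : g →ₗ[ℝ] g →ₗ[ℝ] ℝ} {e : ι → g}
  {V : Type*} [AddCommGroup V] [Module ℝ V] [LieRingModule g V]

/-- Double divergence of the cyclic sum of `F (Φ x y) z` for an equivariant `F`. -/
theorem sum_sum_lie_lie_equivariant (h : IsCasimirFrame B e) {Φ : g →ₗ[ℝ] g →ₗ[ℝ] g}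
    (alt : ∀ x y, Φ x y = -Φ y x) (hdiv : ∀ y, ∑ i, ⁅e i, Φ (e i) y⁆ = 0)
    (hcon : ∀ v, ∑ i, Φ (e i) ⁅e i, v⁆ = 0) {F : g →ₗ[ℝ] g →ₗ[ℝ] V}
    (hF : ∀ u p q : g, ⁅u, F p q⁆ = F ⁅u, p⁆ q + F p ⁅u, q⁆) (z : g) :
    ∑ i, ∑ j, ⁅e i, ⁅e j, F (Φ (e i) (e j)) z + F (Φ (e j) z) (e i) + F (Φ z (e i)) (e j)⁆⁆
      = ∑ j, F (Φ (e j) z) (e j) + ∑ i, ∑ j, F ⁅e i, Φ (e j) z⁆ ⁅e j, e i⁆ := by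
  have hdiv' : ∀ y, ∑ i, ⁅e i, Φ y (e i)⁆ = 0 := fun y => by
    simp only [alt y, lie_neg, Finset.sum_neg_distrib, hdiv, neg_zero]
  simp only [lie_add, Finset.sum_add_distrib]
  have h1 : ∑ i, ∑ j, ⁅e i, ⁅e j, F (Φ (e i) (e j)) z⁆⁆ = 0 := by
    have hs : ∑ i, ∑ j, F (Φ (e i) (e j)) ⁅e i, ⁅e j, z⁆⁆ = 0 := by
      have h1 : ∑ i, ∑ j, F (Φ (e i) (e j)) ⁅⁅e i, e j⁆, z⁆ = 0 := by
        have : ∀ i, ∑ j, F (Φ (e i) (e j)) ⁅⁅e i, e j⁆, z⁆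
            = -∑ j, F (Φ (e i) ⁅e i, e j⁆) ⁅e j, z⁆ := fun i => by
          have := h.sum_lie (e i) (fun x y => F (Φ (e i) y) ⁅x, z⁆) (by constructor <;> simp)
          simp only [← lie_skew _ (e i), neg_lie, map_neg, LinearMap.neg_apply,
            Finset.sum_neg_distrib, neg_neg] at this
          rw [← this, neg_neg]
        simp only [this, Finset.sum_neg_distrib]
        rw [Finset.sum_comm]
        simp only [← LinearMap.sum_apply, ← map_sum, hcon, map_zero, LinearMap.zero_apply,
          Finset.sum_const_zero, neg_zero]
      have h2 : ∑ i, ∑ j, F (Φ (e i) (e j)) ⁅e j, ⁅e i, z⁆⁆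
          = -∑ i, ∑ j, F (Φ (e i) (e j)) ⁅e i, ⁅e j, z⁆⁆ := by
        rw [Finset.sum_comm]
        simp only [← Finset.sum_neg_distrib]
        refine Finset.sum_congr rfl fun i _ => Finset.sum_congr rfl fun j _ => ?_
        rw [alt, map_neg, LinearMap.neg_apply]
      simp only [lie_lie (e _) (e _) z, map_sub, Finset.sum_sub_distrib, h2] at h1
      linear_combination (norm := module) (1 / 2 : ℝ) • h1
    simp only [hF, lie_add, Finset.sum_add_distrib, hs, add_zero]
    rw [Finset.sum_comm (f := fun i j => F ⁅e i, Φ (e i) (e j)⁆ ⁅e j, z⁆)]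
    simp only [← LinearMap.sum_apply, ← map_sum, ← _root_.lie_sum, hdiv, hdiv', lie_zero, map_zero,
      LinearMap.zero_apply, Finset.sum_const_zero, add_zero]
  have h2 : ∑ i, ∑ j, ⁅e i, ⁅e j, F (Φ (e j) z) (e i)⁆⁆
      = ∑ j, F (Φ (e j) z) (e j) + ∑ i, ∑ j, F ⁅e i, Φ (e j) z⁆ ⁅e j, e i⁆ := by
    have h4 : ∑ i, ∑ j, F (Φ (e j) z) ⁅e i, ⁅e j, e i⁆⁆ = ∑ j, F (Φ (e j) z) (e j) := by
      rw [Finset.sum_comm]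
      refine Finset.sum_congr rfl fun j _ => ?_
      simp only [← lie_skew (e j), lie_neg, ← map_sum, Finset.sum_neg_distrib, h.casimir, neg_neg]
    simp only [hF, lie_add, Finset.sum_add_distrib, h4, lie_self, map_zero, Finset.sum_const_zero]
    simp only [← LinearMap.sum_apply, ← map_sum, ← _root_.lie_sum, hdiv, lie_zero, map_zero,
      LinearMap.zero_apply, Finset.sum_const_zero]
    abel
  have h3 : ∑ i, ∑ j, ⁅e i, ⁅e j, F (Φ z (e i)) (e j)⁆⁆ = 0 := by
    have h4 : ∑ i, ∑ j, F ⁅⁅e i, e j⁆, Φ z (e i)⁆ (e j)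
        = -∑ i, ∑ j, F ⁅e j, Φ z (e i)⁆ ⁅e i, e j⁆ := by
      rw [← Finset.sum_neg_distrib]
      refine Finset.sum_congr rfl fun i _ => ?_
      have := h.sum_lie (e i) (fun x y => F ⁅x, Φ z (e i)⁆ y) (by constructor <;> simp)
      simpa only [← lie_skew _ (e i), neg_lie, map_neg, LinearMap.neg_apply,
        Finset.sum_neg_distrib, neg_neg, neg_eq_iff_eq_neg] using this
    have h5 : ∑ i, ∑ j, F ⁅e j, ⁅e i, Φ z (e i)⁆⁆ (e j) = 0 := by
      rw [Finset.sum_comm]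
      simp only [← LinearMap.sum_apply, ← map_sum, ← _root_.lie_sum, hdiv', lie_zero, map_zero,
        LinearMap.zero_apply, Finset.sum_const_zero]
    have h6 : ∀ i j, ⁅e i, ⁅e j, Φ z (e i)⁆⁆
        = ⁅⁅e i, e j⁆, Φ z (e i)⁆ + ⁅e j, ⁅e i, Φ z (e i)⁆⁆ := fun i j => leibniz_lie _ _ _
    simp only [hF, lie_add, Finset.sum_add_distrib, lie_self, lie_zero, map_zero,
      Finset.sum_const_zero, h6, map_add, LinearMap.add_apply, h4, h5]
    abel
  rw [h1, h2, h3]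
  module

variable [LieModule ℝ g V]

theorem sum_lie_lie_smul (h : IsCasimirFrame B e) (z : g) (v : V) :
    ∑ i, ⁅e i, ⁅⁅e i, z⁆, v⁆⁆ = -((1 / 2 : ℝ) • ⁅z, v⁆) := by
  have h1 := h.sum_lie z (fun x y => ⁅x, ⁅y, v⁆⁆) (by constructor <;> simp)
  have h2 : ∑ i, ⁅⁅e i, ⁅e i, z⁆⁆, v⁆ = -⁅z, v⁆ := by
    rw [← _root_.sum_lie, h.casimir, neg_lie]
  simp only [lie_lie (e _) ⁅e _, z⁆, Finset.sum_sub_distrib, h1] at h2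
  linear_combination (norm := module) (1 / 2 : ℝ) • h2

theorem sum_sum_lie_lie_smul (h : IsCasimirFrame B e) (v : V) :
    ∑ i, ∑ j, ⁅e i, ⁅e j, ⁅⁅e i, e j⁆, v⁆⁆⁆ = (1 / 2 : ℝ) • ∑ j, ⁅e j, ⁅e j, v⁆⁆ := by
  have h1 := h.sum_sum_lie_lie (fun x y => ⁅x, ⁅y, v⁆⁆) (by constructor <;> simp)
  simp only [lie_lie (e _) (e _) ⁅⁅e _, e _⁆, v⁆, Finset.sum_sub_distrib] at h1
  have h2 : ∑ i, ∑ j, ⁅e j, ⁅e i, ⁅⁅e i, e j⁆, v⁆⁆⁆ = -∑ i, ∑ j, ⁅e i, ⁅e j, ⁅⁅e i, e j⁆, v⁆⁆⁆ := by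
    rw [Finset.sum_comm]
    simp only [← Finset.sum_neg_distrib]
    refine Finset.sum_congr rfl fun i _ => Finset.sum_congr rfl fun j _ => ?_
    rw [← lie_skew (e j) (e i), neg_lie, lie_neg, lie_neg]
  rw [h2] at h1
  rw [← h1]
  module

/-- Double divergence of the cocycle expression `⁅⁅x, y⁆, k z⁆ + cyclic`. -/
theorem sum_sum_lie_lie_cyclic (h : IsCasimirFrame B e) {k : g →ₗ[ℝ] V} {c r : ℝ}
    (hdiv : ∑ i, ⁅e i, k (e i)⁆ = 0) (hc : ∀ z, ∑ i, ⁅e i, ⁅e i, k z⁆⁆ = c • k z)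
    (hr : ∀ z, ∑ i, ⁅⁅e i, z⁆, k (e i)⁆ = r • k z) (z : g) :
    ∑ i, ∑ j, ⁅e i, ⁅e j, ⁅⁅e i, e j⁆, k z⁆ + ⁅⁅e j, z⁆, k (e i)⁆ + ⁅⁅z, e i⁆, k (e j)⁆⁆⁆
      = (r ^ 2 - r / 2 + c / 2) • k z := by
  simp only [lie_add, Finset.sum_add_distrib]
  rw [h.sum_sum_lie_lie_smul, hc]
  have h1 : ∑ i, ∑ j, ⁅e i, ⁅e j, ⁅⁅e j, z⁆, k (e i)⁆⁆⁆ = -((r / 2) • k z) := by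
    simp only [← _root_.lie_sum, h.sum_lie_lie_smul, lie_neg, lie_smul, Finset.sum_neg_distrib,
      ← Finset.smul_sum, leibniz_lie _ z, Finset.sum_add_distrib, hr, hdiv, lie_zero]
    module
  have h2 : ∀ w, ∑ j, ⁅e j, ⁅w, k (e j)⁆⁆ = r • k w := fun w => by
    simp only [leibniz_lie _ w, Finset.sum_add_distrib, hr, ← _root_.lie_sum, hdiv, lie_zero,
      add_zero]
  have h3 : ∑ i, ⁅e i, k ⁅z, e i⁆⁆ = r • k z := by
    have := h.sum_lie z (fun x y => ⁅x, k y⁆) (by constructor <;> simp)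
    rw [hr] at this
    simp only [← lie_skew z, map_neg, lie_neg, Finset.sum_neg_distrib, this]
  have h4 : ∑ i, ∑ j, ⁅e i, ⁅e j, ⁅⁅z, e i⁆, k (e j)⁆⁆⁆ = r ^ 2 • k z := by
    simp only [← _root_.lie_sum, h2, lie_smul, ← Finset.smul_sum, h3]
    module
  rw [h1, h4]
  module

theorem sum_sum_form_defect (h : IsCasimirFrame B e) {k : g →ₗ[ℝ] V} {c r : ℝ}
    (hc : ∀ z, ∑ i, ⁅e i, ⁅e i, k z⁆⁆ = c • k z) (hr : ∀ z, ∑ i, ⁅⁅e i, z⁆, k (e i)⁆ = r • k z)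
    {N : V →ₗ[ℝ] V →ₗ[ℝ] ℝ} (hsymm : ∀ v w, N v w = N w v)
    (hinv : ∀ (u : g) (v w : V), N ⁅u, v⁆ w = -N v ⁅u, w⁆) :
    ∑ j, ∑ i, N (⁅e i, k (e j)⁆ - k ⁅e i, e j⁆) (⁅e i, k (e j)⁆ - k ⁅e i, e j⁆)
      = (1 - c - 2 * r) * ∑ j, N (k (e j)) (k (e j)) := by
  have h1 : ∀ i j, N (⁅e i, k (e j)⁆ - k ⁅e i, e j⁆) (⁅e i, k (e j)⁆ - k ⁅e i, e j⁆)
      = -N (k (e j)) ⁅e i, ⁅e i, k (e j)⁆⁆ - 2 * N ⁅e i, k (e j)⁆ (k ⁅e i, e j⁆)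
        + N (k ⁅e i, e j⁆) (k ⁅e i, e j⁆) := fun i j => by
    simp only [map_sub, LinearMap.sub_apply, ← hinv, hsymm (k ⁅e i, e j⁆) ⁅e i, k (e j)⁆]
    ring
  have h2 : ∑ j, ∑ i, N ⁅e i, k (e j)⁆ (k ⁅e i, e j⁆) = r * ∑ j, N (k (e j)) (k (e j)) := by
    have h3 : ∀ j, ∑ i, N ⁅e i, k (e j)⁆ (k ⁅e i, e j⁆)
        = ∑ i, N ⁅⁅e j, e i⁆, k (e j)⁆ (k (e i)) := fun j => by
      have := h.sum_lie (e j) (fun x y => N ⁅x, k (e j)⁆ (k y)) (by constructor <;> simp)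
      simp only [← lie_skew _ (e j), neg_lie, map_neg, LinearMap.neg_apply,
        Finset.sum_neg_distrib, neg_neg] at this ⊢
      linarith
    rw [Finset.sum_congr rfl fun j _ => h3 j, Finset.sum_comm]
    simp only [← LinearMap.sum_apply, ← map_sum, hr, map_smul, LinearMap.smul_apply, smul_eq_mul,
      ← Finset.mul_sum]
  have h3 : ∑ j, ∑ i, N (k ⁅e i, e j⁆) (k ⁅e i, e j⁆) = ∑ j, N (k (e j)) (k (e j)) := by
    rw [Finset.sum_comm]
    exact h.sum_sum_lie_lie (fun x y => N (k x) (k y)) (by constructor <;> simp)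
  simp only [h1, Finset.sum_add_distrib, Finset.sum_sub_distrib, Finset.sum_neg_distrib,
    ← Finset.mul_sum, h2, h3, ← map_sum, hc, map_smul, smul_eq_mul]
  ring

/-- A map whose equivariance defect has vanishing norm is zero unless the Casimir eigenvalue of
its image is that of the adjoint representation. -/
theorem eq_zero_of_defect (h : IsCasimirFrame B e) {k : g →ₗ[ℝ] V} {c r : ℝ}
    (hc : ∀ z, ∑ i, ⁅e i, ⁅e i, k z⁆⁆ = c • k z) (hr : ∀ z, ∑ i, ⁅⁅e i, z⁆, k (e i)⁆ = r • k z)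
    {N : V →ₗ[ℝ] V →ₗ[ℝ] ℝ} (hsymm : ∀ v w, N v w = N w v)
    (hinv : ∀ (u : g) (v w : V), N ⁅u, v⁆ w = -N v ⁅u, w⁆) (hpos : ∀ v, 0 ≤ N v v)
    (hdef : ∀ v, N v v = 0 → v = 0) (hcr : 1 - c - 2 * r = 0) (hc1 : c ≠ -1) : k = 0 := by
  have h1 := h.sum_sum_form_defect hc hr hsymm hinv
  rw [hcr, zero_mul, Finset.sum_eq_zero_iff_of_nonneg fun j _ => Finset.sum_nonneg fun i _ =>
    hpos _] at h1
  have h2 : ∀ i j, ⁅e i, k (e j)⁆ - k ⁅e i, e j⁆ = 0 := fun i j => by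
    have h3 := h1 j (Finset.mem_univ j)
    rw [Finset.sum_eq_zero_iff_of_nonneg fun i _ => hpos _] at h3
    exact hdef _ (h3 i (Finset.mem_univ i))
  have h3 : ∀ i x, ⁅e i, k x⁆ = k ⁅e i, x⁆ := fun i x => by
    have := h.eq_zero_of_frame
      (LieModule.toEnd ℝ g V (e i) ∘ₗ k - k ∘ₗ (ad ℝ g (e i) : g →ₗ[ℝ] g)) fun j => by
        simpa using h2 i j
    exact sub_eq_zero.mp (by simpa using LinearMap.congr_fun this x)
  ext z
  have h4 := hc z
  simp only [h3, ← map_sum, h.casimir, map_neg] at h4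
  have h5 : (c + 1) • k z = 0 := by
    linear_combination (norm := module) -(1 : ℝ) • h4
  exact (smul_eq_zero.mp h5).resolve_left fun h6 => hc1 (by linarith)

end IsCasimirFrame

section FrameForm

variable {g ι : Type*} [LieRing g] [LieAlgebra ℝ g] [Fintype ι]

/-- The trace form `(P, Q) ↦ ∑ ⟨P eₐ, Q eₐ⟩` on endomorphisms. -/
noncomputable def frameForm (B : g →ₗ[ℝ] g →ₗ[ℝ] ℝ) (e : ι → g) :
    (g →ₗ[ℝ] g) →ₗ[ℝ] (g →ₗ[ℝ] g) →ₗ[ℝ] ℝ :=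
  ∑ a, B.compl₁₂ (LinearMap.applyₗ (e a)) (LinearMap.applyₗ (e a))

/-- The endomorphism `a ↦ ⟨p, a⟩ q - ⟨q, a⟩ p`. -/
noncomputable def formWedge (B : g →ₗ[ℝ] g →ₗ[ℝ] ℝ) : g →ₗ[ℝ] g →ₗ[ℝ] g →ₗ[ℝ] g :=
  LinearMap.mk₂ ℝ (fun p q => (B p).smulRight q - (B q).smulRight p)
    (fun _ _ _ => by ext; simp; module) (fun _ _ _ => by ext; simp; module)
    (fun _ _ _ => by ext; simp; module) (fun _ _ _ => by ext; simp; module)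

variable {B : g →ₗ[ℝ] g →ₗ[ℝ] ℝ} {e : ι → g}

theorem frameForm_apply (P Q : g →ₗ[ℝ] g) : frameForm B e P Q = ∑ a, B (P (e a)) (Q (e a)) := by
  simp [frameForm, LinearMap.sum_apply]

theorem formWedge_apply (p q a : g) : formWedge B p q a = B p a • q - B q a • p := by
  simp [formWedge]

namespace IsCasimirFrame

theorem lie_formWedge (h : IsCasimirFrame B e) (u p q : g) :
    ⁅u, formWedge B p q⁆ = formWedge B ⁅u, p⁆ q + formWedge B p ⁅u, q⁆ := by
  ext a
  simp only [LieHom.lie_apply, formWedge_apply, LinearMap.add_apply, h.inv_left, lie_sub, lie_smul]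
  module

theorem frameForm_symm (h : IsCasimirFrame B e) (P Q : g →ₗ[ℝ] g) :
    frameForm B e P Q = frameForm B e Q P := by
  simp only [frameForm_apply, h.symm (P _)]

theorem frameForm_lie (h : IsCasimirFrame B e) (u : g) (P Q : g →ₗ[ℝ] g) :
    frameForm B e ⁅u, P⁆ Q = -frameForm B e P ⁅u, Q⁆ := by
  have := h.sum_adjoint (P := fun x => ⁅u, x⁆) (Q := fun x => -⁅u, x⁆)
      (fun x y => by rw [h.inv_left, map_neg]) (fun x y => B (P x) (Q y))
      (by constructor <;> simp)
  simp only [map_neg, Finset.sum_neg_distrib] at this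
  simp only [frameForm_apply, LieHom.lie_apply, map_sub, LinearMap.sub_apply, this,
    Finset.sum_sub_distrib, h.inv_left, Finset.sum_neg_distrib]
  ring

theorem frameForm_self_nonneg (h : IsCasimirFrame B e) (P : g →ₗ[ℝ] g) : 0 ≤ frameForm B e P P := by
  rw [frameForm_apply]
  exact Finset.sum_nonneg fun _ _ => h.form_self_nonneg _

theorem eq_zero_of_frameForm_self (h : IsCasimirFrame B e) (P : g →ₗ[ℝ] g)
    (hP : frameForm B e P P = 0) : P = 0 := by
  rw [frameForm_apply, Finset.sum_eq_zero_iff_of_nonneg fun _ _ => h.form_self_nonneg _] at hP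
  exact h.eq_zero_of_frame P fun j => h.eq_zero_of_form_self (hP j (Finset.mem_univ j))

end IsCasimirFrame

end FrameForm

namespace IsBianchiPair

variable {g ι : Type*} [LieRing g] [LieAlgebra ℝ g] [Fintype ι]
  {B : g →ₗ[ℝ] g →ₗ[ℝ] ℝ} {e : ι → g} {K Φ : g →ₗ[ℝ] g →ₗ[ℝ] g}

theorem sum_lie_map_lie (h : IsBianchiPair B e K Φ) (z a : g) :
    ∑ i, ⁅e i, K z ⁅e i, a⁆⁆ = 0 := by
  have := h.toIsCasimirFrame.sum_lie a (fun x y => ⁅x, K z y⁆) (by constructor <;> simp)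
  simp only [← lie_skew ⁅_, a⁆, Finset.sum_neg_distrib, h.sum_lie_lie_right', neg_zero] at this
  exact neg_eq_zero.mp this.symm

theorem casimir_apply (h : IsBianchiPair B e K Φ) (z : g) :
    ∑ i, ⁅e i, ⁅e i, K z⁆⁆ = (-2 : ℝ) • K z := by
  ext a
  simp only [LinearMap.sum_apply, LieHom.lie_apply, lie_sub, Finset.sum_sub_distrib, h.casimir,
    h.sum_lie_map_lie, ← map_sum, LinearMap.smul_apply, map_neg]
  module

theorem sum_map_lie_eq_zero (h : IsBianchiPair B e K Φ) (hn : 4 < Fintype.card ι) (v : g) :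
    ∑ i, Φ (e i) ⁅e i, v⁆ = 0 ∧ ∑ i, K (e i) ⁅e i, v⁆ = 0 := by
  have hT : ∀ x y, K x y - K y x + (2 : ℝ) • Φ x y = (0 : g →ₗ[ℝ] g) ⁅x, y⁆ := fun x y => by
    rw [h.torsion_eq_zero hn, LinearMap.zero_apply]
  have h1 := h.map_eq_smul (by omega) (by simp) hT v
  have h2 := h.sum_apply_lie (by omega) (by simp) hT v
  have hn' : (4 : ℝ) < Fintype.card ι := by exact_mod_cast hn
  have h3 : ∑ i, Φ (e i) ⁅e i, v⁆ = 0 :=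
    (smul_eq_zero.mp h1.symm).resolve_left (by linarith)
  exact ⟨h3, by rw [h2, h3, smul_zero]⟩

theorem sum_lie_eq_zero (h : IsBianchiPair B e K Φ) (hn : 4 < Fintype.card ι) (y : g) :
    ∑ i, ⁅e i, Φ (e i) y⁆ = 0 := by
  refine h.toIsCasimirFrame.ext_form fun v => ?_
  have := h.two_mul_sum_form y v
  rw [(h.sum_map_lie_eq_zero hn v).1] at this
  simp only [map_zero, LinearMap.zero_apply] at this
  simp only [map_sum, LinearMap.sum_apply, h.toIsCasimirFrame.inv_left, Finset.sum_neg_distrib,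
    map_zero, LinearMap.zero_apply]
  linarith

theorem form_apply (h : IsBianchiPair B e K Φ) (hn : 4 < Fintype.card ι) (x y z : g) :
    B (K x y) z = 2 * B (Φ y z) x := by
  have h1 : ∀ x y z, 2 * B (Φ x y) z = B (K y x) z - B (K x y) z := fun x y z => by
    have := congrArg (fun u => B u z) (h.torsion_eq_zero hn x y)
    simp only [map_add, map_sub, map_smul, LinearMap.add_apply, LinearMap.sub_apply,
      LinearMap.smul_apply, smul_eq_mul, map_zero, LinearMap.zero_apply] at this
    linarith
  have h2 : ∀ x y z, B (K x y) z = -B (K x z) y := fun x y z => by rw [h.skew, h.symm]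
  linarith [h.cyclic x y z, h1 x y z, h1 y z x, h1 z x y, h2 x y z, h2 y z x, h2 z x y]

theorem div_eq_zero (h : IsBianchiPair B e K Φ) (hn : 4 < Fintype.card ι) :
    ∑ i, ⁅e i, K (e i)⁆ = 0 := by
  ext a
  have h1 : ∑ i, ⁅e i, K (e i) a⁆ = 0 := h.toIsCasimirFrame.ext_form fun v => by
    have := congrArg (B a) (h.sum_map_lie_eq_zero hn v).2
    simp only [map_sum, LinearMap.sum_apply, h.toIsCasimirFrame.inv_left, h.skew, neg_neg,
      map_zero, LinearMap.zero_apply] at this ⊢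
    exact this
  simp only [LinearMap.sum_apply, LieHom.lie_apply, Finset.sum_sub_distrib, h1,
    (h.sum_map_lie_eq_zero hn a).2, LinearMap.zero_apply, sub_zero]

theorem sum_lie_lie_apply (h : IsBianchiPair B e K Φ) (hn : 4 < Fintype.card ι) (z : g) :
    ∑ i, ⁅⁅e i, z⁆, K (e i)⁆ = ((Fintype.card ι - 3) / 2 : ℝ) • K z := by
  have hf := h.toIsCasimirFrame
  ext x
  refine hf.ext_form fun y => ?_
  have h0 := h.contracted_bianchi x y
  have hδ := h.sum_apply_self_eq_zero (A := 0) (by omega) (by simp)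
    fun x y => by rw [h.torsion_eq_zero hn, LinearMap.zero_apply]
  have h1 : ∀ w : g, ∑ i, K (e i) ⁅w, e i⁆ = 0 := fun w => by
    simp only [← lie_skew w, map_neg, Finset.sum_neg_distrib, (h.sum_map_lie_eq_zero hn w).2,
      neg_zero]
  simp only [hδ, h1, h.trace_eq_zero (by omega), lie_zero, zero_smul] at h0
  have h2 := congrArg (fun u => B u z) h0
  simp only [map_add, map_sub, map_smul, LinearMap.add_apply, LinearMap.sub_apply, map_sum,
    LinearMap.sum_apply, LinearMap.smul_apply, smul_eq_mul, map_zero, LinearMap.zero_apply,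
    h.inv] at h2
  have h3 : ∀ i, B (⁅⁅e i, z⁆, K (e i)⁆ x) y
      = B (K (e i) x) ⁅y, ⁅e i, z⁆⁆ - B (K (e i) y) ⁅x, ⁅e i, z⁆⁆ := fun i => by
    rw [LieHom.lie_apply, map_sub, LinearMap.sub_apply, hf.inv_left, h.skew _ ⁅_, x⁆,
      sub_neg_eq_add,
      ← lie_skew y, map_neg, ← lie_skew x, map_neg, h.symm (K (e i) y)]
    ring
  simp only [LinearMap.sum_apply, map_sum, h3, Finset.sum_sub_distrib, LinearMap.smul_apply,
    map_smul, smul_eq_mul, h.form_apply hn]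
  simp only [h.form_apply hn] at h2
  linarith

theorem sum_formWedge (h : IsBianchiPair B e K Φ) (hn : 4 < Fintype.card ι) (z : g) :
    ∑ j, formWedge B (Φ (e j) z) (e j) = (-1 / 2 : ℝ) • K z := by
  have hf := h.toIsCasimirFrame
  ext a
  refine hf.ext_form fun b => ?_
  have h1 : ∑ j, B (e j) b * B (Φ (e j) z) a = B (Φ b z) a := by
    simpa [h.symm b] using hf.sum_expand (fun u => B (Φ u z) a) ⟨by simp, by simp⟩ b
  have h2 : ∑ j, B (e j) a * B (Φ (e j) z) b = B (Φ a z) b := by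
    simpa [h.symm a] using hf.sum_expand (fun u => B (Φ u z) b) ⟨by simp, by simp⟩ a
  simp only [LinearMap.sum_apply, formWedge_apply, map_sum, map_sub, map_smul,
    LinearMap.sub_apply, LinearMap.smul_apply, smul_eq_mul, Finset.sum_sub_distrib, h2,
    mul_comm (B (Φ _ z) a), h1, h.form_apply hn]
  have := h.cyclic a b z
  rw [h.alt z a, map_neg, LinearMap.neg_apply] at this
  linarith

theorem sum_sum_formWedge_lie (h : IsBianchiPair B e K Φ) (hn : 4 < Fintype.card ι) (z : g) :
    ∑ i, ∑ j, formWedge B ⁅e i, Φ (e j) z⁆ ⁅e j, e i⁆ = 0 := by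
  have hf := h.toIsCasimirFrame
  ext a
  refine hf.ext_form fun b => ?_
  have h1 : ∀ u w, ∑ j, B (e j) w * B (Φ (e j) z) u = B (Φ w z) u := fun u w => by
    simpa [h.symm w] using hf.sum_expand (fun v => B (Φ v z) u) ⟨by simp, by simp⟩ w
  have h2 : ∀ i, ∑ j, B (formWedge B ⁅e i, Φ (e j) z⁆ ⁅e j, e i⁆ a) b
      = (1 / 2 : ℝ) * B ⁅e i, K z ⁅e i, b⁆⁆ a := fun i => by
    simp only [formWedge_apply, map_sub, map_smul, LinearMap.sub_apply, LinearMap.smul_apply,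
      smul_eq_mul, hf.inv_left (e i), h.inv (e _), neg_mul, mul_neg, sub_neg_eq_add,
      Finset.sum_add_distrib, Finset.sum_neg_distrib, h1, mul_comm (B (Φ _ z) ⁅e i, a⁆),
      h.form_apply hn]
    have := h.cyclic ⁅e i, a⁆ z ⁅e i, b⁆
    rw [h.alt z, map_neg, LinearMap.neg_apply, h.alt ⁅e i, b⁆ ⁅e i, a⁆] at this
    rw [h.alt ⁅e i, b⁆ ⁅e i, a⁆]
    simp only [map_neg, LinearMap.neg_apply] at this ⊢
    linarith
  simp only [LinearMap.sum_apply, map_sum, h2, ← Finset.mul_sum, LinearMap.zero_apply, map_zero]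
  rw [← LinearMap.sum_apply, ← map_sum, h.sum_lie_map_lie, map_zero, LinearMap.zero_apply, mul_zero]

theorem bianchi_lie (h : IsBianchiPair B e K Φ) (x y z : g) :
    (⁅⁅x, y⁆, K z⁆ + ⁅⁅y, z⁆, K x⁆ + ⁅⁅z, x⁆, K y⁆)
      + (formWedge B (Φ x y) z + formWedge B (Φ y z) x + formWedge B (Φ z x) y)
      + (ad ℝ g (⁅K x y - K y x, z⁆ + ⁅K y z - K z y, x⁆ + ⁅K z x - K x z, y⁆) : g →ₗ[ℝ] g)
      = 0 := by
  ext a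
  rw [LinearMap.zero_apply, ← h.bianchi x y z a]
  simp only [LinearMap.add_apply, LieHom.lie_apply, formWedge_apply, ad_apply, add_lie]
  abel

theorem frameForm_ad (h : IsBianchiPair B e K Φ) (z v : g) :
    frameForm B e (K z) (ad ℝ g v : g →ₗ[ℝ] g) = 0 := by
  simpa only [frameForm_apply, ad_apply] using h.orth z v

theorem lie_ad (u v : g) : ⁅u, (ad ℝ g v : g →ₗ[ℝ] g)⁆ = (ad ℝ g ⁅u, v⁆ : g →ₗ[ℝ] g) := by
  ext a
  rw [LieHom.lie_apply, ad_apply, ad_apply, ad_apply, lie_lie]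

theorem eq_zero (h : IsBianchiPair B e K Φ) (hn : 4 < Fintype.card ι) : K = 0 := by
  have hf := h.toIsCasimirFrame
  by_cases h6 : Fintype.card ι = 6
  · refine hf.eq_zero_of_defect h.casimir_apply (h.sum_lie_lie_apply hn) hf.frameForm_symm
      hf.frameForm_lie hf.frameForm_self_nonneg hf.eq_zero_of_frameForm_self ?_ (by norm_num)
    rw [h6]
    norm_num
  ext1 z
  refine hf.eq_zero_of_frameForm_self _ ?_
  have h0 := Finset.sum_eq_zero fun i (_ : i ∈ Finset.univ) => Finset.sum_eq_zero
    fun j (_ : j ∈ Finset.univ) => congrArg (fun P => ⁅e i, ⁅e j, P⁆⁆)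
      (h.bianchi_lie (e i) (e j) z) |>.trans (by simp)
  have h1 : ∀ (u w v : g) (P Q : g →ₗ[ℝ] g), ⁅u, ⁅w, P + Q + (ad ℝ g v : g →ₗ[ℝ] g)⁆⁆
      = ⁅u, ⁅w, P⁆⁆ + ⁅u, ⁅w, Q⁆⁆ + (ad ℝ g ⁅u, ⁅w, v⁆⁆ : g →ₗ[ℝ] g) := fun u w v P Q => by
    rw [lie_add, lie_add, lie_add, lie_add, lie_ad, lie_ad]
  rw [Finset.sum_congr rfl fun i _ => Finset.sum_congr rfl fun j _ => h1 _ _ _ _ _] at h0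
  simp only [Finset.sum_add_distrib] at h0
  rw [hf.sum_sum_lie_lie_cyclic (h.div_eq_zero hn) h.casimir_apply (h.sum_lie_lie_apply hn),
    hf.sum_sum_lie_lie_equivariant h.alt (h.sum_lie_eq_zero hn)
      (fun v => (h.sum_map_lie_eq_zero hn v).1) hf.lie_formWedge,
    h.sum_formWedge hn, h.sum_sum_formWedge_lie hn] at h0
  have h2 := congrArg (frameForm B e (K z)) h0
  simp only [map_add, map_sum, map_smul, map_zero, h.frameForm_ad, Finset.sum_const_zero,
    smul_eq_mul, add_zero] at h2
  have h3 : ((Fintype.card ι - 1) * (Fintype.card ι - 6) / 4 : ℝ)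
      * frameForm B e (K z) (K z) = 0 := by
    linear_combination h2
  have hn' : (4 : ℝ) < Fintype.card ι := by exact_mod_cast hn
  have h6' : (Fintype.card ι : ℝ) ≠ 6 := by exact_mod_cast h6
  exact (mul_eq_zero.mp h3).resolve_left (div_ne_zero
    (mul_ne_zero (by linarith) (sub_ne_zero.mpr h6')) (by norm_num))

theorem eq_zero_right (h : IsBianchiPair B e K Φ) (hn : 4 < Fintype.card ι) (x y : g) :
    Φ x y = 0 := by
  have := h.torsion_eq_zero hn x y
  simpa [h.eq_zero hn] using this

end IsBianchiPair

theorem cyclic_sum_lie_eq_zero {L : Type*} [LieRing L] (x y z u v w a : L) :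
    (⁅⁅x, y⁆, ⁅w, a⁆⁆ - ⁅w, ⁅⁅x, y⁆, a⁆⁆ + ⁅⁅⁅u, y⁆ - ⁅v, x⁆, z⁆, a⁆)
    + (⁅⁅y, z⁆, ⁅u, a⁆⁆ - ⁅u, ⁅⁅y, z⁆, a⁆⁆ + ⁅⁅⁅v, z⁆ - ⁅w, y⁆, x⁆, a⁆)
    + (⁅⁅z, x⁆, ⁅v, a⁆⁆ - ⁅v, ⁅⁅z, x⁆, a⁆⁆ + ⁅⁅⁅w, x⁆ - ⁅u, z⁆, y⁆, a⁆) = 0 := by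
  simp only [lie_lie, sub_lie, lie_sub]
  abel

theorem exists_isCasimirFrame (g : Type*) [LieRing g] [LieAlgebra ℝ g] [Module.Finite ℝ g]
    (hneg : ∀ X : g, X ≠ 0 → killingForm ℝ g X X < 0) :
    ∃ e : Fin (Module.finrank ℝ g) → g, IsCasimirFrame (-killingForm ℝ g) e := by
  have hsymm : ∀ x y : g, killingForm ℝ g x y = killingForm ℝ g y x :=
    LieModule.traceForm_comm ℝ g g
  have hinv : ∀ x y z : g, killingForm ℝ g ⁅x, y⁆ z = killingForm ℝ g x ⁅y, z⁆ :=
    LieModule.traceForm_apply_lie_apply ℝ g g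
  let core : InnerProductSpace.Core ℝ g :=
    { inner x y := -killingForm ℝ g x y
      conj_inner_symm x y := by simp [hsymm x y]
      re_inner_nonneg x := by
        by_cases hx : x = 0
        · simp [hx]
        · simpa using (hneg x hx).le
      add_left x y z := by simp; ring
      smul_left x y r := by simp
      definite x hx := by
        by_contra h
        have := hneg x h
        linarith }
  let _ : NormedAddCommGroup g := core.toNormedAddCommGroup
  let _ : InnerProductSpace ℝ g := InnerProductSpace.ofCore core.toCore
  let b := stdOrthonormalBasis ℝ g
  have hinner : ∀ x y : g, inner ℝ x y = -killingForm ℝ g x y := fun _ _ => rfl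
  have hexpand : ∀ x : g, ∑ i, (-killingForm ℝ g) x (b i) • b i = x := fun x => by
    have := b.sum_repr' x
    simpa only [hinner, hsymm _ x, LinearMap.neg_apply] using this
  refine ⟨b, fun x y => by simp [hsymm x y], fun x y z => by simp [hinv], hexpand, fun i => ?_,
    fun x => ?_⟩
  · have := b.inner_eq_one i
    simpa only [hinner, LinearMap.neg_apply] using this
  · have h1 : ∀ y, killingForm ℝ g (∑ i, ⁅b i, ⁅b i, x⁆⁆) y = killingForm ℝ g (-x) y := fun y => by
      have h2 := LinearMap.trace_eq_sum_inner (ad ℝ g x ∘ₗ ad ℝ g y) b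
      rw [← killingForm_apply_apply] at h2
      rw [map_neg, LinearMap.neg_apply, h2, map_sum, LinearMap.sum_apply, ← Finset.sum_neg_distrib]
      refine Finset.sum_congr rfl fun i _ => ?_
      rw [hinner, neg_neg, LinearMap.comp_apply, ad_apply, ad_apply, ← hinv, ← lie_skew (b i),
        map_neg, LinearMap.neg_apply, hinv, ← lie_skew y, map_neg]
    rw [← hexpand (∑ i, ⁅b i, ⁅b i, x⁆⁆), ← hexpand (-x)]
    simp only [LinearMap.neg_apply, h1]

theorem stmt_0 (g : Type*) [LieRing g] [LieAlgebra ℝ g] [Module.Finite ℝ g]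
    [LieAlgebra.IsSimple ℝ g]
    (hneg : ∀ X : g, X ≠ 0 → killingForm ℝ g X X < 0)
    (hdim : 4 < Module.finrank ℝ g)
    (K : g →ₗ[ℝ] Module.End ℝ g)
    (hskew : ∀ Z X Y : g, ip ℝ g (K Z X) Y + ip ℝ g X (K Z Y) = 0)
    (Φ : g →ₗ[ℝ] g →ₗ[ℝ] g)
    (hΦalt : ∀ X : g, Φ X X = 0)
    (hi : ∀ X Y Z : g, ip ℝ g (Φ X Y) Z + ip ℝ g (Φ Y Z) X + ip ℝ g (Φ Z X) Y = 0)
    (hii : ∀ X Y Z : g,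
      (⁅ad ℝ g ⁅X, Y⁆, K Z⁆ + ad ℝ g ⁅K X Y - K Y X, Z⁆ + wedge ℝ g (Φ X Y) Z)
      + (⁅ad ℝ g ⁅Y, Z⁆, K X⁆ + ad ℝ g ⁅K Y Z - K Z Y, X⁆ + wedge ℝ g (Φ Y Z) X)
      + (⁅ad ℝ g ⁅Z, X⁆, K Y⁆ + ad ℝ g ⁅K Z X - K X Z, Y⁆ + wedge ℝ g (Φ Z X) Y) = 0) :
    (∀ X Y : g, Φ X Y = 0) ∧ (∀ Z : g, ∃ U : g, K Z = ad ℝ g U) := by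
  obtain ⟨e, hf⟩ := exists_isCasimirFrame g hneg
  let U : g →ₗ[ℝ] g :=
    { toFun Z := -∑ i, ⁅K Z (e i), e i⁆
      map_add' Z W := by
        simp only [map_add, LinearMap.add_apply, add_lie, Finset.sum_add_distrib, neg_add]
      map_smul' c Z := by
        simp only [map_smul, LinearMap.smul_apply, smul_lie, ← Finset.smul_sum, smul_neg,
          RingHom.id_apply] }
  have hU : ∀ Z, U Z = -∑ i, ⁅K Z (e i), e i⁆ := fun Z => rfl
  let K' : g →ₗ[ℝ] g →ₗ[ℝ] g := K - (ad ℝ g : g →ₗ[ℝ] Module.End ℝ g) ∘ₗ U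
  have hK' : ∀ Z X, K' Z X = K Z X - ⁅U Z, X⁆ := fun Z X => rfl
  have h : IsBianchiPair (-killingForm ℝ g) e K' Φ :=
    { hf with
      skew := fun Z X Y => by
        have := hskew Z X Y
        have h1 := hf.inv_left (U Z) X Y
        simp only [ip] at this
        simp only [hK', map_sub, LinearMap.sub_apply, LinearMap.neg_apply] at h1 ⊢
        linarith
      orth := fun Z W => by
        have h1 : ∀ i, (-killingForm ℝ g) (K Z (e i)) ⁅W, e i⁆
            = -(-killingForm ℝ g) ⁅K Z (e i), e i⁆ W := fun i => by
          rw [hf.inv, ← lie_skew W, map_neg]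
        have h2 : ∑ i, (-killingForm ℝ g) ⁅U Z, e i⁆ ⁅W, e i⁆ = (-killingForm ℝ g) (U Z) W := by
          rw [← hf.sum_form_lie_lie]
          refine Finset.sum_congr rfl fun i _ => ?_
          rw [← lie_skew W, ← lie_skew (U Z), map_neg, map_neg, LinearMap.neg_apply, neg_neg]
        simp only [hK', map_sub, LinearMap.sub_apply, Finset.sum_sub_distrib, h2, h1]
        rw [hU, map_neg, map_sum, LinearMap.neg_apply, LinearMap.sum_apply,
          Finset.sum_neg_distrib, sub_self]
      alt := fun X Y => by
        have := hΦalt (X + Y)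
        simp only [map_add, LinearMap.add_apply, hΦalt, zero_add, add_zero] at this
        rw [add_comm] at this
        exact eq_neg_of_add_eq_zero_left this
      cyclic := fun X Y Z => hi X Y Z
      bianchi := fun X Y Z a => by
        have h1 := LinearMap.congr_fun (hii X Y Z) a
        simp only [LinearMap.add_apply, LieRing.of_associative_ring_bracket, LinearMap.sub_apply,
          Module.End.mul_apply, ad_apply, wedge, LinearMap.smulRight_apply,
          LinearMap.zero_apply] at h1
        have h2 := cyclic_sum_lie_eq_zero X Y Z (U X) (U Y) (U Z) a
        simp only [hK', lie_sub, sub_lie] at h1 h2 ⊢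
        linear_combination (norm := module) h1 - h2 }
  have hn : 4 < Fintype.card (Fin (Module.finrank ℝ g)) := by rwa [Fintype.card_fin]
  refine ⟨h.eq_zero_right hn, fun Z => ⟨U Z, ?_⟩⟩
  ext X
  have := hK' Z X
  rw [h.eq_zero hn, LinearMap.zero_apply, LinearMap.zero_apply] at this
  exact (sub_eq_zero.mp this.symm)
end

section
/- Under the hypotheses of the Proposition (dim g > 4, K and Φ satisfying (i) and (ii)) together with the condition Tr(K_Z ∘ ad_U) = 0 for all Z,U ∈ g, one has Φ(X,Y) = (1/2)(K_Y X − K_X Y) for all X, Y ∈ g. -/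
open LieAlgebra

/-- An invariant symmetric bilinear form on a real Lie algebra with a finite Parseval frame on which
the Casimir operator of the adjoint representation is `-1`. -/
structure InvariantFrame {g ι : Type*} [LieRing g] [LieAlgebra ℝ g] [Fintype ι]
    (B : LinearMap.BilinForm ℝ g) (e : ι → g) : Prop where
  symm : ∀ X Y : g, B X Y = B Y X
  inv : ∀ X Y Z : g, B ⁅X, Y⁆ Z = B X ⁅Y, Z⁆
  expand : ∀ X : g, ∑ i, B X (e i) • e i = X
  casimir : ∀ X : g, ∑ i, ⁅e i, ⁅e i, X⁆⁆ = -X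

theorem trace_eq_sum_of_expand {V ι : Type*} [AddCommGroup V] [Module ℝ V] [Module.Finite ℝ V]
    [Fintype ι] {B : LinearMap.BilinForm ℝ V} {e : ι → V} (hB : ∀ X Y, B X Y = B Y X)
    (he : ∀ X, ∑ i, B X (e i) • e i = X) (A : Module.End ℝ V) :
    LinearMap.trace ℝ V A = ∑ i, B (A (e i)) (e i) := by
  have hA : A = ∑ i, (B (e i)).smulRight (A (e i)) := by
    ext X
    simp only [LinearMap.sum_apply, LinearMap.smulRight_apply]
    conv_lhs => rw [← he X]
    rw [map_sum]
    exact Finset.sum_congr rfl fun i _ => by rw [map_smul, hB]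
  conv_lhs => rw [hA]
  rw [map_sum]
  exact Finset.sum_congr rfl fun i _ => by rw [LinearMap.trace_smulRight, hB]

namespace InvariantFrame

variable {g ι M : Type*} [LieRing g] [LieAlgebra ℝ g] [Fintype ι] [AddCommGroup M] [Module ℝ M]
  {B : LinearMap.BilinForm ℝ g} {e : ι → g}

theorem inv' (h : InvariantFrame B e) (X Y Z : g) : B X ⁅Y, Z⁆ = -B ⁅Y, X⁆ Z := by
  rw [← h.inv, ← lie_skew, map_neg, LinearMap.neg_apply]

theorem eq_zero (h : InvariantFrame B e) {X : g} (hX : ∀ Y, B X Y = 0) : X = 0 := by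
  rw [← h.expand X]; simp [hX]

theorem sum_apply (h : InvariantFrame B e) (f : g →ₗ[ℝ] M) (X : g) :
    ∑ i, B X (e i) • f (e i) = f X := by
  conv_rhs => rw [← h.expand X]
  simp

theorem sum_swap (h : InvariantFrame B e) (T : g →ₗ[ℝ] g →ₗ[ℝ] M) {A A' : Module.End ℝ g}
    (hA : ∀ X Y, B (A X) Y = B X (A' Y)) :
    ∑ i, T (A (e i)) (e i) = ∑ i, T (e i) (A' (e i)) := by
  have h1 : ∀ i, T (A (e i)) (e i) = ∑ j, B (A (e i)) (e j) • T (e j) (e i) := fun i =>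
    (h.sum_apply (T.flip (e i)) (A (e i))).symm
  have h2 : ∀ j, T (e j) (A' (e j)) = ∑ i, B (A' (e j)) (e i) • T (e j) (e i) := fun j =>
    (h.sum_apply (T (e j)) (A' (e j))).symm
  simp_rw [h1, h2]
  rw [Finset.sum_comm]
  refine Finset.sum_congr rfl fun j _ => Finset.sum_congr rfl fun i _ => ?_
  rw [hA, h.symm]

theorem sum_swap_lie (h : InvariantFrame B e) (T : g →ₗ[ℝ] g →ₗ[ℝ] M) (U : g) :
    ∑ i, T ⁅U, e i⁆ (e i) = ∑ i, T (e i) ⁅e i, U⁆ := by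
  have := h.sum_swap T (A := ad ℝ g U) (A' := -ad ℝ g U) (fun X Y => by
    rw [LinearMap.neg_apply, map_neg, ad_apply, ad_apply, h.inv', neg_neg])
  simpa using this

theorem sum_swap_skew (h : InvariantFrame B e) (T : g →ₗ[ℝ] g →ₗ[ℝ] M) {A : Module.End ℝ g}
    (hA : ∀ X Y, B (A X) Y = -B X (A Y)) :
    ∑ i, T (A (e i)) (e i) = -∑ i, T (e i) (A (e i)) := by
  have := h.sum_swap T (A := A) (A' := -A) (fun X Y => by simp [hA])
  simpa using this

theorem sum_comp_swap (h : InvariantFrame B e) (A C : Module.End ℝ g) :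
    ∑ i, B (A (C (e i))) (e i) = ∑ i, B (C (A (e i))) (e i) := by
  have h1 : ∀ i, B (A (C (e i))) (e i) = ∑ j, B (C (e i)) (e j) * B (A (e j)) (e i) := fun i => by
    simpa using (h.sum_apply (B.flip (e i) ∘ₗ A) (C (e i))).symm
  have h2 : ∀ i, B (C (A (e i))) (e i) = ∑ j, B (A (e i)) (e j) * B (C (e j)) (e i) := fun i => by
    simpa using (h.sum_apply (B.flip (e i) ∘ₗ C) (A (e i))).symm
  simp_rw [h1, h2]
  rw [Finset.sum_comm]
  exact Finset.sum_congr rfl fun j _ => Finset.sum_congr rfl fun i _ => mul_comm _ _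

/-- The Killing form is `-B`. -/
theorem sum_ad_ad (h : InvariantFrame B e) (X Y : g) :
    ∑ i, B ⁅X, ⁅Y, e i⁆⁆ (e i) = -B X Y := by
  have h1 : ∀ i, B ⁅X, ⁅Y, e i⁆⁆ (e i) = B X ⁅e i, ⁅e i, Y⁆⁆ := fun i => by
    rw [h.inv, ← lie_skew ⁅Y, e i⁆, ← lie_skew Y, lie_neg, neg_neg]
  simp_rw [h1]
  rw [← map_sum, h.casimir, map_neg]

section Skew

variable {A : Module.End ℝ g}

theorem sum_lie_apply (h : InvariantFrame B e)
    (hT : ∀ U : g, ∑ i, B (A ⁅U, e i⁆) (e i) = 0) : ∑ i, ⁅A (e i), e i⁆ = 0 := by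
  refine h.eq_zero fun U => ?_
  have := h.sum_swap_lie (B ∘ₗ A) U
  simp only [LinearMap.comp_apply, hT] at this
  simp only [map_sum, LinearMap.sum_apply, h.inv, ← this]

theorem sum_apply_lie_lie (h : InvariantFrame B e) (hA : ∀ X Y, B (A X) Y = -B X (A Y))
    (hT : ∀ U : g, ∑ i, B (A ⁅U, e i⁆) (e i) = 0) (U : g) :
    ∑ i, ⁅⁅A (e i), U⁆, e i⁆ = 0 ∧ ∑ i, ⁅⁅e i, U⁆, A (e i)⁆ = 0 := by
  have h1 : ∑ i, ⁅⁅A (e i), U⁆, e i⁆ = -∑ i, ⁅⁅e i, U⁆, A (e i)⁆ := by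
    simpa only [LinearMap.comp_apply, LinearMap.neg_apply, ad_apply, LieHom.coe_toLinearMap,
      lie_skew] using h.sum_swap_skew ((ad ℝ g : g →ₗ[ℝ] Module.End ℝ g) ∘ₗ (-(ad ℝ g U))) hA
  have h2 : ∑ i, ⁅⁅A (e i), U⁆, e i⁆ - ∑ i, ⁅⁅e i, U⁆, A (e i)⁆ = 0 := by
    have h3 : ∀ i, ⁅⁅A (e i), U⁆, e i⁆ - ⁅⁅e i, U⁆, A (e i)⁆ = ⁅⁅A (e i), e i⁆, U⁆ := fun i => by
      rw [lie_lie (A (e i)) (e i) U, ← lie_skew ⁅A (e i), U⁆ (e i), ← lie_skew ⁅e i, U⁆ (A (e i))]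
      abel
    rw [← Finset.sum_sub_distrib]
    simp_rw [h3]
    rw [← sum_lie, h.sum_lie_apply hT, zero_lie]
  constructor
  · linear_combination (norm := module) (1 / 2 : ℝ) • h1 + (1 / 2 : ℝ) • h2
  · linear_combination (norm := module) (1 / 2 : ℝ) • h1 - (1 / 2 : ℝ) • h2

theorem sum_apply_lie (h : InvariantFrame B e) (hA : ∀ X Y, B (A X) Y = -B X (A Y))
    (hT : ∀ U : g, ∑ i, B (A ⁅U, e i⁆) (e i) = 0) (U : g) :
    ∑ i, ⁅A ⁅e i, U⁆, e i⁆ = 0 := by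
  have h1 := h.sum_swap_lie ((ad ℝ g : g →ₗ[ℝ] Module.End ℝ g) ∘ₗ A) U
  have h2 := (h.sum_apply_lie_lie hA hT U).2
  simp at h1
  have h3 : ∀ i, ⁅A ⁅e i, U⁆, e i⁆ = -⁅A ⁅U, e i⁆, e i⁆ := fun i => by
    rw [← lie_skew U, map_neg, neg_lie, neg_neg]
  have h4 : ∀ i, ⁅A (e i), ⁅e i, U⁆⁆ = -⁅⁅e i, U⁆, A (e i)⁆ := fun i => (lie_skew _ _).symm
  simp_rw [h3, Finset.sum_neg_distrib, h1, h4, Finset.sum_neg_distrib, h2, neg_zero]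

theorem sum_apply_ad_ad (h : InvariantFrame B e) (hA : ∀ X Y, B (A X) Y = -B X (A Y))
    (hT : ∀ U : g, ∑ i, B (A ⁅U, e i⁆) (e i) = 0) (U V : g) :
    ∑ i, B (A ⁅U, ⁅V, e i⁆⁆) (e i) = 0 := by
  have h1 : ∀ i, B (A ⁅U, ⁅V, e i⁆⁆) (e i) = B V ⁅⁅A (e i), U⁆, e i⁆ := fun i => by
    have h2 := h.inv' ⁅V, e i⁆ U (A (e i))
    have h3 : ⁅⁅A (e i), U⁆, e i⁆ = ⁅e i, ⁅U, A (e i)⁆⁆ := by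
      rw [← lie_skew, ← lie_skew (A (e i)), lie_neg, neg_neg]
    rw [hA, h3, ← h.inv, h2]
  simp_rw [h1]
  rw [← map_sum, (h.sum_apply_lie_lie hA hT U).1, map_zero]

end Skew

end InvariantFrame

/-- Contraction of the first argument of a `g`-valued bilinear map against the Lie bracket. -/
noncomputable def lieContraction {g ι : Type*} [LieRing g] [LieAlgebra ℝ g] [Fintype ι]
    (e : ι → g) (Ψ : g →ₗ[ℝ] g →ₗ[ℝ] g) : Module.End ℝ g :=
  -∑ i, Ψ (e i) ∘ₗ ad ℝ g (e i)

/-- The operator `A ↦ ∑ i, ad (e i) ∘ A ∘ ad (e i)`. -/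
noncomputable def adConj {g ι : Type*} [LieRing g] [LieAlgebra ℝ g] [Fintype ι]
    (e : ι → g) (A : Module.End ℝ g) : Module.End ℝ g :=
  ∑ i, ad ℝ g (e i) ∘ₗ A ∘ₗ ad ℝ g (e i)

namespace InvariantFrame

variable {g ι : Type*} [LieRing g] [LieAlgebra ℝ g] [Fintype ι]
  {B : LinearMap.BilinForm ℝ g} {e : ι → g}

theorem lieContraction_apply (Ψ : g →ₗ[ℝ] g →ₗ[ℝ] g) (U : g) :
    lieContraction e Ψ U = -∑ i, Ψ (e i) ⁅e i, U⁆ := by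
  simp [lieContraction]

theorem adConj_apply (A : Module.End ℝ g) (U : g) :
    adConj e A U = ∑ i, ⁅e i, A ⁅e i, U⁆⁆ := by
  simp [adConj]

section Curvature

variable {Ψ : g →ₗ[ℝ] g →ₗ[ℝ] g}

/-- Pair symmetry of algebraic curvature tensors. -/
theorem pair_symm (h : InvariantFrame B e) (hΨ : ∀ X Y, Ψ X Y = -Ψ Y X)
    (hJ : ∀ X Y Z : g, ⁅Ψ X Y, Z⁆ + ⁅Ψ Y Z, X⁆ + ⁅Ψ Z X, Y⁆ = 0) (X Y Z W : g) :
    B (Ψ X Y) ⁅Z, W⁆ = B (Ψ Z W) ⁅X, Y⁆ := by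
  have hb : ∀ X Y Z W : g, B (Ψ X Y) ⁅Z, W⁆ + B (Ψ Y Z) ⁅X, W⁆ + B (Ψ Z X) ⁅Y, W⁆ = 0 := by
    intro X Y Z W
    rw [← h.inv, ← h.inv, ← h.inv, ← LinearMap.add_apply, ← LinearMap.add_apply, ← map_add,
      ← map_add, hJ, map_zero, LinearMap.zero_apply]
  have h1 : ∀ X Y Z W : g, B (Ψ X Y) ⁅Z, W⁆ = -B (Ψ Y X) ⁅Z, W⁆ := fun X Y Z W => by
    rw [hΨ X Y, map_neg, LinearMap.neg_apply]
  have h2 : ∀ X Y Z W : g, B (Ψ X Y) ⁅Z, W⁆ = -B (Ψ X Y) ⁅W, Z⁆ := fun X Y Z W => by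
    rw [← lie_skew, map_neg]
  linarith [hb X Y Z W, hb Y Z W X, hb Z W X Y, hb W X Y Z, h2 Y Z X W, h1 Z X Y W, h2 Y Z W X,
    h2 Z W Y X, h2 W Y Z X, h2 Z W X Y, h1 W X Z Y, h2 X Z W Y, h2 W X Y Z, h2 X Y W Z,
    h1 X Z W Y, h1 W Y Z X, h1 Y W X Z, h1 Y W Z X, h2 Y W X Z, h2 X Y Z W, h2 X Z Y W, h1 X Z Y W]

theorem curvature_apply (h : InvariantFrame B e) (hΨ : ∀ X Y, Ψ X Y = -Ψ Y X)
    (hJ : ∀ X Y Z : g, ⁅Ψ X Y, Z⁆ + ⁅Ψ Y Z, X⁆ + ⁅Ψ Z X, Y⁆ = 0) (X Y W : g) :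
    B (Ψ X Y) W = B (lieContraction e Ψ W) ⁅X, Y⁆ := by
  have h1 : B (Ψ X Y) W = -∑ i, B (Ψ X Y) ⁅e i, ⁅e i, W⁆⁆ := by
    rw [← map_sum, h.casimir, map_neg, neg_neg]
  simp_rw [h1, lieContraction_apply, h.pair_symm hΨ hJ X Y]
  simp

theorem lieContraction_symm (h : InvariantFrame B e) (hΨ : ∀ X Y, Ψ X Y = -Ψ Y X)
    (hJ : ∀ X Y Z : g, ⁅Ψ X Y, Z⁆ + ⁅Ψ Y Z, X⁆ + ⁅Ψ Z X, Y⁆ = 0) (V W : g) :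
    B (lieContraction e Ψ V) W = B V (lieContraction e Ψ W) := by
  rw [lieContraction_apply, h.symm V]
  simp only [map_neg, map_sum, LinearMap.neg_apply, LinearMap.sum_apply,
    h.curvature_apply hΨ hJ (e _) _ W]
  rw [← map_sum, h.casimir, map_neg, neg_neg]

theorem curvature_eq (h : InvariantFrame B e) (hΨ : ∀ X Y, Ψ X Y = -Ψ Y X)
    (hJ : ∀ X Y Z : g, ⁅Ψ X Y, Z⁆ + ⁅Ψ Y Z, X⁆ + ⁅Ψ Z X, Y⁆ = 0) (X Y : g) :
    Ψ X Y = lieContraction e Ψ ⁅X, Y⁆ := by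
  refine sub_eq_zero.1 (h.eq_zero fun W => ?_)
  rw [map_sub, LinearMap.sub_apply, h.curvature_apply hΨ hJ, h.lieContraction_symm hΨ hJ,
    h.symm W, h.lieContraction_symm hΨ hJ, h.symm, sub_eq_zero, h.symm]

end Curvature

section Symmetric

variable {φ : Module.End ℝ g}

theorem bilin_adConj (h : InvariantFrame B e) (A : Module.End ℝ g) (U V : g) :
    B (adConj e A U) V = -∑ i, B (A ⁅U, e i⁆) ⁅V, e i⁆ := by
  rw [adConj_apply, map_sum, LinearMap.sum_apply, ← Finset.sum_neg_distrib]
  refine Finset.sum_congr rfl fun i _ => ?_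
  have := h.inv' (A ⁅e i, U⁆) (e i) V
  rw [← lie_skew U, ← lie_skew V, map_neg, map_neg, map_neg, LinearMap.neg_apply, neg_neg, this,
    neg_neg]

theorem adConj_symm (h : InvariantFrame B e) (hφ : ∀ X Y, B (φ X) Y = B X (φ Y)) (X Y : g) :
    B (adConj e φ X) Y = B X (adConj e φ Y) := by
  rw [h.symm X, h.bilin_adConj, h.bilin_adConj]
  congr 1
  exact Finset.sum_congr rfl fun i _ => by rw [hφ, h.symm]

theorem eq_of_quadratic_eq (h : InvariantFrame B e) {P Q : Module.End ℝ g}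
    (hP : ∀ X Y, B (P X) Y = B X (P Y)) (hQ : ∀ X Y, B (Q X) Y = B X (Q Y))
    (hPQ : ∀ X, B (P X) X = B (Q X) X) : P = Q := by
  ext X
  refine sub_eq_zero.1 (h.eq_zero fun Y => ?_)
  have h1 := hPQ (X + Y)
  simp only [map_add, LinearMap.add_apply] at h1
  rw [map_sub, LinearMap.sub_apply]
  linarith [hPQ X, hPQ Y, hP X Y, hQ X Y, h.symm X (P Y), h.symm X (Q Y)]

theorem bilin_adConj_eq_trace (h : InvariantFrame B e) (A : Module.End ℝ g) (U V : g) :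
    B (adConj e A U) V = ∑ i, B (A ⁅U, ⁅V, e i⁆⁆) (e i) := by
  have h1 := h.sum_comp_swap (A ∘ₗ ad ℝ g U) (ad ℝ g V)
  simp only [LinearMap.comp_apply, ad_apply] at h1
  rw [h.bilin_adConj, h1, ← Finset.sum_neg_distrib]
  exact Finset.sum_congr rfl fun i _ => by rw [h.inv', neg_neg]

theorem bilin_adConj_skew (h : InvariantFrame B e) {A : Module.End ℝ g}
    (hA : ∀ X Y, B (A X) Y = -B X (A Y)) (Z V : g) :
    2 * B (adConj e A Z) V = ∑ i, B (A ⁅⁅Z, V⁆, e i⁆) (e i) := by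
  have h1 : B (adConj e A V) Z = -B (adConj e A Z) V := by
    rw [h.bilin_adConj, h.bilin_adConj, neg_neg, ← Finset.sum_neg_distrib]
    exact Finset.sum_congr rfl fun i _ => by rw [hA, neg_neg, h.symm]
  have h2 := h.bilin_adConj_eq_trace A Z V
  have h3 := h.bilin_adConj_eq_trace A V Z
  simp only [lie_lie, map_sub, LinearMap.sub_apply, Finset.sum_sub_distrib]
  linarith

/-- The skew-symmetrization `φ ∘ ad W + ad W ∘ φ` is mapped by `adConj` into inner derivations. -/
theorem adConj_anticommutator (h : InvariantFrame B e) (hφ : ∀ X Y, B (φ X) Y = B X (φ Y))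
    (W Z : g) :
    adConj e (φ ∘ₗ ad ℝ g W + ad ℝ g W ∘ₗ φ) Z = ⁅adConj e φ W, Z⁆ := by
  refine sub_eq_zero.1 (h.eq_zero fun V => ?_)
  have hA : ∀ X Y, B ((φ ∘ₗ ad ℝ g W + ad ℝ g W ∘ₗ φ) X) Y =
      -B X ((φ ∘ₗ ad ℝ g W + ad ℝ g W ∘ₗ φ) Y) := fun X Y => by
    simp only [LinearMap.add_apply, LinearMap.comp_apply, ad_apply, map_add]
    rw [← hφ X, h.inv' X, h.inv' (φ X), hφ ⁅W, X⁆]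
    linarith [h.inv' (φ X) W Y, h.inv' X W (φ Y)]
  have h1 := h.bilin_adConj_skew hA Z V
  have h2 := h.sum_comp_swap (ad ℝ g W) (φ ∘ₗ ad ℝ g ⁅Z, V⁆)
  have h3 := h.bilin_adConj_eq_trace φ W ⁅Z, V⁆
  have h4 := h.bilin_adConj_eq_trace φ ⁅Z, V⁆ W
  have h5 := h.adConj_symm hφ W ⁅Z, V⁆
  simp only [LinearMap.add_apply, LinearMap.comp_apply, ad_apply, map_add,
    Finset.sum_add_distrib] at h1 h2
  rw [map_sub, LinearMap.sub_apply, h.inv]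
  linarith [h.symm W (adConj e φ ⁅Z, V⁆)]

theorem adConj_lie (h : InvariantFrame B e) (hφ : ∀ X Y, B (φ X) Y = B X (φ Y))
    (hJ : ∀ X Y Z : g, ⁅φ ⁅X, Y⁆, Z⁆ + ⁅φ ⁅Y, Z⁆, X⁆ + ⁅φ ⁅Z, X⁆, Y⁆ = 0) (W Z : g) :
    adConj e φ ⁅W, Z⁆ + ⁅W, adConj e φ Z⁆ = ⁅adConj e φ W, Z⁆ - ⁅φ W, Z⁆ := by
  have h1 : ∀ i, ⁅φ ⁅e i, ⁅e i, W⁆⁆, Z⁆ = ⁅e i, φ ⁅e i, ⁅W, Z⁆⁆⁆ + ⁅W, ⁅e i, φ ⁅e i, Z⁆⁆⁆ -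
      (⁅e i, φ ⁅W, ⁅e i, Z⁆⁆⁆ + ⁅e i, ⁅W, φ ⁅e i, Z⁆⁆⁆) := fun i => by
    have h2 := hJ (e i) ⁅e i, W⁆ Z
    rw [← lie_skew (φ _) (e i), lie_lie (e i) W Z, ← lie_skew Z (e i), map_neg φ ⁅e i, Z⁆, neg_lie,
      ← lie_skew (φ ⁅e i, Z⁆), lie_lie (e i) W, map_sub, lie_sub] at h2
    rw [← sub_eq_zero, ← h2]
    abel
  have h3 := h.adConj_anticommutator hφ W Z
  have h4 : ∑ i, ⁅φ ⁅e i, ⁅e i, W⁆⁆, Z⁆ = -⁅φ W, Z⁆ := by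
    rw [← sum_lie, ← map_sum, h.casimir, map_neg, neg_lie]
  simp_rw [h1] at h4
  simp only [adConj_apply, LinearMap.add_apply, LinearMap.comp_apply, ad_apply, lie_add,
    Finset.sum_add_distrib, Finset.sum_sub_distrib] at h3 h4 ⊢
  rw [lie_sum, ← h3, ← sub_eq_zero, ← sub_eq_zero.2 h4]
  abel

/-- An eigenvector of `adConj` of eigenvalue `c ≠ 1/2` among the curvature operators. -/
theorem smul_lie_of_adConj_eq (h : InvariantFrame B e) (hφ : ∀ X Y, B (φ X) Y = B X (φ Y))
    (hJ : ∀ X Y Z : g, ⁅φ ⁅X, Y⁆, Z⁆ + ⁅φ ⁅Y, Z⁆, X⁆ + ⁅φ ⁅Z, X⁆, Y⁆ = 0) {c : ℝ}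
    (hc : 2 * c ≠ 1) (hP : adConj e φ = c • φ) (W Z : g) : c • φ ⁅W, Z⁆ = -⁅W, φ Z⁆ := by
  have h1 := h.adConj_lie hφ hJ W Z
  have h2 := h.adConj_lie hφ hJ Z W
  simp only [hP, LinearMap.smul_apply, lie_smul, smul_lie] at h1 h2
  rw [← lie_skew Z W, ← lie_skew Z (φ W), ← lie_skew (φ Z) W, map_neg] at h2
  have h3 : (2 * c - 1) • (⁅W, φ Z⁆ - ⁅φ W, Z⁆) = 0 := by
    linear_combination (norm := module) h1 + h2
  have h4 := (smul_eq_zero.1 h3).resolve_left (sub_ne_zero.2 hc)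
  linear_combination (norm := module) h1 + (1 - c) • h4

theorem sq_smul_of_adConj_eq (h : InvariantFrame B e) (hφ : ∀ X Y, B (φ X) Y = B X (φ Y))
    (hJ : ∀ X Y Z : g, ⁅φ ⁅X, Y⁆, Z⁆ + ⁅φ ⁅Y, Z⁆, X⁆ + ⁅φ ⁅Z, X⁆, Y⁆ = 0) {c : ℝ}
    (hc : 2 * c ≠ 1) (hP : adConj e φ = c • φ) : (c ^ 2) • φ = φ := by
  ext X
  have h1 := congrArg (fun A : Module.End ℝ g => c • A X) hP
  simp only [adConj_apply, Finset.smul_sum, ← lie_smul, h.smul_lie_of_adConj_eq hφ hJ hc hP,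
    lie_neg, Finset.sum_neg_distrib, h.casimir, neg_neg, LinearMap.smul_apply] at h1
  rw [LinearMap.smul_apply, pow_two, mul_smul, ← h1]

end Symmetric

end InvariantFrame

/-- Skew-symmetric operators `K Z`, trace-orthogonal to the inner derivations, together with an
alternating map `Φ`, satisfying the algebraic Bianchi identities of the main theorem. -/
structure IsBianchiPair_s7 {g ι : Type*} [LieRing g] [LieAlgebra ℝ g] [Fintype ι]
    (B : LinearMap.BilinForm ℝ g) (e : ι → g) (K Φ : g →ₗ[ℝ] g →ₗ[ℝ] g) : Prop
    extends InvariantFrame B e where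
  skew : ∀ Z X Y : g, B (K Z X) Y = -B X (K Z Y)
  trace_ad : ∀ Z U : g, ∑ i, B (K Z ⁅U, e i⁆) (e i) = 0
  alt : ∀ X Y : g, Φ X Y = -Φ Y X
  cyclic : ∀ X Y Z : g, B (Φ X Y) Z + B (Φ Y Z) X + B (Φ Z X) Y = 0
  bianchi : ∀ X Y Z W : g,
    (⁅⁅X, Y⁆, K Z W⁆ - K Z ⁅⁅X, Y⁆, W⁆ + ⁅⁅K X Y - K Y X, Z⁆, W⁆
      + (B (Φ X Y) W • Z - B Z W • Φ X Y))
    + (⁅⁅Y, Z⁆, K X W⁆ - K X ⁅⁅Y, Z⁆, W⁆ + ⁅⁅K Y Z - K Z Y, X⁆, W⁆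
      + (B (Φ Y Z) W • X - B X W • Φ Y Z))
    + (⁅⁅Z, X⁆, K Y W⁆ - K Y ⁅⁅Z, X⁆, W⁆ + ⁅⁅K Z X - K X Z, Y⁆, W⁆
      + (B (Φ Z X) W • Y - B Y W • Φ Z X)) = 0

/-- The map `(X, Y) ↦ K X Y - K Y X + 2 Φ X Y`. -/
noncomputable def defect {g : Type*} [LieRing g] [LieAlgebra ℝ g]
    (K Φ : g →ₗ[ℝ] g →ₗ[ℝ] g) : g →ₗ[ℝ] g →ₗ[ℝ] g :=
  K - K.flip + (2 : ℝ) • Φ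

namespace IsBianchiPair_s7

variable {g ι : Type*} [LieRing g] [LieAlgebra ℝ g] [Fintype ι]
  {B : LinearMap.BilinForm ℝ g} {e : ι → g} {K Φ : g →ₗ[ℝ] g →ₗ[ℝ] g}

theorem defect_apply (X Y : g) : defect K Φ X Y = K X Y - K Y X + (2 : ℝ) • Φ X Y := by
  simp [defect]

theorem defect_alt (h : IsBianchiPair_s7 B e K Φ) (X Y : g) :
    defect K Φ X Y = -defect K Φ Y X := by
  rw [defect_apply, defect_apply, h.alt X Y]
  module

theorem trace_bianchi_term (h : IsBianchiPair_s7 B e K Φ) (X Y Z U : g) :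
    ∑ i, B (⁅⁅X, Y⁆, K Z ⁅U, e i⁆⁆ - K Z ⁅⁅X, Y⁆, ⁅U, e i⁆⁆ + ⁅⁅K X Y - K Y X, Z⁆, ⁅U, e i⁆⁆
      + (B (Φ X Y) ⁅U, e i⁆ • Z - B Z ⁅U, e i⁆ • Φ X Y)) (e i)
    = -B ⁅defect K Φ X Y, Z⁆ U := by
  have h1 := h.sum_comp_swap (ad ℝ g ⁅X, Y⁆) (K Z ∘ₗ ad ℝ g U)
  simp only [LinearMap.comp_apply, ad_apply] at h1
  have h2 : ∀ A C : g, ∑ i, B A ⁅U, e i⁆ * B C (e i) = B A ⁅U, C⁆ := fun A C => by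
    simpa [mul_comm] using h.sum_apply (B A ∘ₗ ad ℝ g U) C
  simp only [map_add, map_sub, map_smul, LinearMap.add_apply, LinearMap.sub_apply,
    LinearMap.smul_apply, Finset.sum_add_distrib, Finset.sum_sub_distrib, smul_eq_mul, h1,
    h.sum_apply_ad_ad (h.skew Z) (h.trace_ad Z), h.sum_ad_ad, h2, defect_apply, add_lie, sub_lie,
    smul_lie]
  have h3 : B Z ⁅U, Φ X Y⁆ = B ⁅Φ X Y, Z⁆ U := by
    rw [h.symm, h.inv, h.symm]
  have h4 : B (Φ X Y) ⁅U, Z⁆ = -B ⁅Φ X Y, Z⁆ U := by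
    rw [h.inv, ← lie_skew, map_neg]
  rw [h3, h4]
  ring

theorem defect_jacobi (h : IsBianchiPair_s7 B e K Φ) (X Y Z : g) :
    ⁅defect K Φ X Y, Z⁆ + ⁅defect K Φ Y Z, X⁆ + ⁅defect K Φ Z X, Y⁆ = 0 := by
  refine h.eq_zero fun U => ?_
  have h1 := h.trace_bianchi_term X Y Z U
  have h2 := h.trace_bianchi_term Y Z X U
  have h3 := h.trace_bianchi_term Z X Y U
  have h4 : ∑ i, B (0 : g) (e i) = 0 := by simp
  have h5 : ∀ i, (0 : g) = _ := fun i => (h.bianchi X Y Z ⁅U, e i⁆).symm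
  rw [Finset.sum_congr rfl fun i _ => congrArg (fun V => B V (e i)) (h5 i)] at h4
  simp only [map_add B, LinearMap.add_apply, Finset.sum_add_distrib] at h1 h2 h3 h4 ⊢
  linarith

theorem ricci (h : IsBianchiPair_s7 B e K Φ) (X Y : g) :
    ⁅⁅X, Y⁆, ∑ i, K (e i) (e i)⁆ - lieContraction e K ⁅X, Y⁆
      + ∑ i, (⁅⁅K (e i) X, Y⁆, e i⁆ - ⁅⁅K (e i) Y, X⁆, e i⁆)
      + (3 - ∑ i, B (e i) (e i)) • Φ X Y
      + ((∑ i, B (Φ Y (e i)) (e i)) • X - (∑ i, B (Φ X (e i)) (e i)) • Y) = 0 := by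
  have hc : ∀ X : g, ∑ i, ⁅⁅X, e i⁆, e i⁆ = -X := fun X => by
    rw [← h.casimir X]
    exact Finset.sum_congr rfl fun i _ => by rw [← lie_skew, ← lie_skew X, lie_neg, neg_neg]
  have h1 : ∑ i, K (e i) ⁅⁅X, Y⁆, e i⁆ = lieContraction e K ⁅X, Y⁆ := by
    rw [InvariantFrame.lieContraction_apply, ← Finset.sum_neg_distrib]
    exact Finset.sum_congr rfl fun i _ => by rw [← lie_skew, map_neg]
  have h2 := (h.sum_apply_lie_lie (h.skew X) (h.trace_ad X) Y).2
  have h3 := (h.sum_apply_lie_lie (h.skew Y) (h.trace_ad Y) X).2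
  have h4 := (h.sum_apply_lie_lie (h.skew X) (h.trace_ad X) Y).1
  have h5 := (h.sum_apply_lie_lie (h.skew Y) (h.trace_ad Y) X).1
  have h2' : ∑ i, ⁅⁅Y, e i⁆, K X (e i)⁆ = 0 := by
    rw [← neg_zero, ← h2, ← Finset.sum_neg_distrib]
    exact Finset.sum_congr rfl fun i _ => by rw [← lie_skew Y, neg_lie]
  have h6 : ∑ i, K Y ⁅⁅e i, X⁆, e i⁆ = K Y X := by
    have h0 : ∑ i, ⁅⁅e i, X⁆, e i⁆ = -∑ i, ⁅⁅X, e i⁆, e i⁆ := by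
      rw [← Finset.sum_neg_distrib]
      exact Finset.sum_congr rfl fun i _ => by rw [← lie_skew (e i) X, neg_lie]
    rw [← map_sum, h0, hc, neg_neg]
  have h7 : ∑ i, K X ⁅⁅Y, e i⁆, e i⁆ = -K X Y := by
    rw [← map_sum, hc, map_neg]
  have h8 := h.expand (Φ X Y)
  have h9 := h.sum_apply (Φ Y) X
  have h10 : ∑ i, B Y (e i) • Φ (e i) X = Φ Y X := h.sum_apply (Φ.flip X) Y
  have h11 : ∑ i, B (Φ (e i) X) (e i) = -∑ i, B (Φ X (e i)) (e i) := by
    rw [← Finset.sum_neg_distrib]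
    exact Finset.sum_congr rfl fun i _ => by rw [h.alt, map_neg, LinearMap.neg_apply]
  have h12 := hc (K X Y)
  have h13 := hc (K Y X)
  have key : ∑ i : ι, (0 : g) = 0 := Finset.sum_const_zero
  rw [Finset.sum_congr rfl fun i _ => (h.bianchi X Y (e i) (e i)).symm] at key
  simp only [Finset.sum_add_distrib, Finset.sum_sub_distrib, sub_lie, ← Finset.sum_smul, h1, h2',
    h3, h4, h5, h6, h7, h8, h9, h10, h11, h12, h13] at key
  rw [lie_sum, Finset.sum_sub_distrib]
  rw [h.alt Y X] at key
  linear_combination (norm := module) key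

theorem ricci_contraction (h : IsBianchiPair_s7 B e K Φ) (U : g) :
    B (lieContraction e K U) U =
      (3 - ∑ i, B (e i) (e i)) * B (lieContraction e Φ U) U := by
  have hz : ∀ V W : g, B ⁅V, W⁆ V = 0 := fun V W => by
    rw [h.symm, ← h.inv, lie_self, map_zero, LinearMap.zero_apply]
  have h1 : ∑ j, ∑ i, (⁅⁅K (e i) (e j), ⁅e j, U⁆⁆, e i⁆ - ⁅⁅K (e i) ⁅e j, U⁆, e j⁆, e i⁆) = 0 := by
    rw [Finset.sum_comm]
    refine Finset.sum_eq_zero fun i _ => ?_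
    have h2 := (h.sum_apply_lie_lie (h.skew (e i)) (h.trace_ad (e i)) U).2
    have h3 : ∑ j, ⁅K (e i) (e j), ⁅e j, U⁆⁆ = 0 := by
      rw [← neg_zero, ← h2, ← Finset.sum_neg_distrib]
      exact Finset.sum_congr rfl fun j _ => (lie_skew _ _).symm
    rw [Finset.sum_sub_distrib, ← sum_lie, ← sum_lie, h3,
      h.sum_apply_lie (h.skew (e i)) (h.trace_ad (e i)), zero_lie, sub_zero]
  have h4 : ∑ j, (∑ i, B (Φ ⁅e j, U⁆ (e i)) (e i)) * B (e j) U = 0 := by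
    have h5 := h.sum_apply ((∑ i, LinearMap.flip B (e i) ∘ₗ Φ.flip (e i)) ∘ₗ (-(ad ℝ g U))) U
    simp only [LinearMap.comp_apply, LinearMap.neg_apply, ad_apply, lie_skew, lie_self, map_zero,
      LinearMap.sum_apply, LinearMap.flip_apply, smul_eq_mul, neg_zero] at h5
    rw [← h5]
    exact Finset.sum_congr rfl fun j _ => by rw [h.symm U, mul_comm]
  have h6 : ∑ j, Φ (e j) ⁅e j, U⁆ = -lieContraction e Φ U := by
    rw [InvariantFrame.lieContraction_apply, neg_neg]
  have key : ∑ j : ι, (0 : g) = 0 := Finset.sum_const_zero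
  rw [Finset.sum_congr rfl fun j _ => (h.ricci (e j) ⁅e j, U⁆).symm] at key
  rw [Finset.sum_add_distrib, Finset.sum_add_distrib, Finset.sum_add_distrib, h1,
    Finset.sum_sub_distrib, Finset.sum_sub_distrib, ← Finset.smul_sum, h6, ← sum_lie, ← map_sum,
    h.casimir] at key
  have key := congrArg (fun V => B V U) key
  simp only [map_add, map_sub, map_sum, map_neg, map_smul, LinearMap.add_apply,
    LinearMap.sub_apply, LinearMap.sum_apply, LinearMap.neg_apply, LinearMap.smul_apply,
    smul_eq_mul, h4, neg_lie, hz, map_zero, LinearMap.zero_apply] at key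
  have h7 : ∀ j, B ⁅e j, U⁆ U = 0 := fun j => by rw [h.inv, lie_self, map_zero]
  simp only [h7, mul_zero, Finset.sum_const_zero] at key
  linarith

theorem lieContraction_defect (h : IsBianchiPair_s7 B e K Φ) (U : g) :
    lieContraction e (defect K Φ) U =
      (2 : ℝ) • lieContraction e K U + (2 : ℝ) • lieContraction e Φ U := by
  have h1 := h.sum_swap_lie K U
  have h2 : ∑ i, K ⁅e i, U⁆ (e i) = -∑ i, K ⁅U, e i⁆ (e i) := by
    rw [← Finset.sum_neg_distrib]
    exact Finset.sum_congr rfl fun i _ => by rw [← lie_skew, map_neg, LinearMap.neg_apply]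
  simp only [InvariantFrame.lieContraction_apply, defect_apply, Finset.sum_add_distrib,
    Finset.sum_sub_distrib, h2, h1, ← Finset.smul_sum]
  module

theorem bilin_lieContraction (h : IsBianchiPair_s7 B e K Φ) (U : g) :
    B (lieContraction e Φ U) U =
      B (adConj e (lieContraction e (defect K Φ)) U) U + B (lieContraction e K U) U := by
  have h1 : ∑ i, B (Φ ⁅e i, U⁆ U) (e i) = ∑ i, B (Φ U (e i)) ⁅e i, U⁆ := by
    have h2 := h.sum_swap_lie (B ∘ₗ Φ U) U
    simp only [LinearMap.comp_apply] at h2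
    rw [← h2]
    exact Finset.sum_congr rfl fun i _ => by
      rw [h.alt, ← lie_skew]
      simp only [map_neg, neg_neg]
  have h3 : ∑ i, (B (Φ (e i) ⁅e i, U⁆) U + B (Φ ⁅e i, U⁆ U) (e i) + B (Φ U (e i)) ⁅e i, U⁆) = 0 :=
    Finset.sum_eq_zero fun i _ => h.cyclic _ _ _
  have h4 : ∀ i, 2 * B (Φ U (e i)) ⁅e i, U⁆ =
      -B (lieContraction e (defect K Φ) ⁅U, e i⁆) ⁅U, e i⁆ - B ⁅K U (e i), e i⁆ U
        - B (K (e i) ⁅e i, U⁆) U := fun i => by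
    rw [← h.curvature_eq h.defect_alt h.defect_jacobi, defect_apply, h.inv, h.symm _ U,
      ← neg_eq_iff_eq_neg.2 (h.skew (e i) U ⁅e i, U⁆), ← lie_skew U]
    simp only [map_add, map_sub, map_smul, map_neg, LinearMap.add_apply, LinearMap.sub_apply,
      LinearMap.smul_apply, smul_eq_mul]
    ring
  have h5 : ∑ i, 2 * B (Φ U (e i)) ⁅e i, U⁆ = _ := Finset.sum_congr rfl fun i _ => h4 i
  have h6 : ∑ i, B ⁅K U (e i), e i⁆ U = 0 := by
    rw [← LinearMap.sum_apply, ← map_sum, h.sum_lie_apply (h.trace_ad U), map_zero,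
      LinearMap.zero_apply]
  rw [← Finset.mul_sum, Finset.sum_sub_distrib, Finset.sum_sub_distrib, h6,
    Finset.sum_neg_distrib] at h5
  rw [Finset.sum_add_distrib, Finset.sum_add_distrib, h1] at h3
  rw [h.bilin_adConj, InvariantFrame.lieContraction_apply Φ, InvariantFrame.lieContraction_apply K]
  simp only [map_neg, map_sum, LinearMap.neg_apply, LinearMap.sum_apply]
  linarith

theorem sum_lieContraction (h : IsBianchiPair_s7 B e K Φ) :
    ∑ j, B (lieContraction e K (e j)) (e j) = 0 := by
  simp only [InvariantFrame.lieContraction_apply, map_neg, map_sum, LinearMap.neg_apply,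
    LinearMap.sum_apply, Finset.sum_neg_distrib]
  rw [Finset.sum_comm]
  simp [h.trace_ad]

theorem adConj_defect (h : IsBianchiPair_s7 B e K Φ) {d : ℝ} (hd : 4 < d)
    (hde : ∑ i, B (e i) (e i) = d) :
    adConj e (lieContraction e (defect K Φ)) =
      ((d - 2) / (2 * (4 - d))) • lieContraction e (defect K Φ) := by
  have hs := h.lieContraction_symm h.defect_alt h.defect_jacobi
  refine h.eq_of_quadratic_eq (h.adConj_symm hs) (fun X Y => ?_) fun U => ?_
  · simp only [LinearMap.smul_apply, map_smul, hs]
  · have h1 := h.ricci_contraction U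
    have h2 := h.bilin_lieContraction U
    rw [hde] at h1
    have h3 : 4 - d ≠ 0 := by linarith
    rw [LinearMap.smul_apply, h.lieContraction_defect U]
    simp only [map_add, map_smul, LinearMap.add_apply, LinearMap.smul_apply, smul_eq_mul]
    have hq : B (adConj e (lieContraction e (defect K Φ)) U) U =
        B (lieContraction e Φ U) U - B (lieContraction e K U) U := by linarith
    rw [hq, h1]
    field_simp
    ring

theorem trace_defect (h : IsBianchiPair_s7 B e K Φ) {d : ℝ} (hd : 4 < d)
    (hde : ∑ i, B (e i) (e i) = d) :
    ∑ j, B (lieContraction e (defect K Φ) (e j)) (e j) = 0 := by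
  have h1 : ∀ j, (3 - d) * B (lieContraction e (defect K Φ) (e j)) (e j) =
      2 * (4 - d) * B (lieContraction e K (e j)) (e j) := fun j => by
    have h2 := h.ricci_contraction (e j)
    rw [hde] at h2
    rw [h.lieContraction_defect]
    simp only [map_add, map_smul, LinearMap.add_apply, LinearMap.smul_apply, smul_eq_mul]
    linear_combination -2 * h2
  have h3 : (3 - d) * ∑ j, B (lieContraction e (defect K Φ) (e j)) (e j) = 0 := by
    rw [Finset.mul_sum, Finset.sum_congr rfl fun j _ => h1 j, ← Finset.mul_sum,
      h.sum_lieContraction, mul_zero]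
  exact (mul_eq_zero.1 h3).resolve_left (by linarith)

/-- The defect is governed by a trace-free symmetric operator commuting with the adjoint action. -/
theorem lieContraction_defect_lie (h : IsBianchiPair_s7 B e K Φ) {d : ℝ} (hd : 4 < d)
    (hde : ∑ i, B (e i) (e i) = d) (W Z : g) :
    lieContraction e (defect K Φ) ⁅W, Z⁆ = ⁅W, lieContraction e (defect K Φ) Z⁆ := by
  have hs := h.lieContraction_symm h.defect_alt h.defect_jacobi
  have hJ := h.defect_jacobi
  simp only [h.curvature_eq h.defect_alt h.defect_jacobi] at hJ
  have hP := h.adConj_defect hd hde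
  set c := (d - 2) / (2 * (4 - d)) with hc
  have h4 : 2 * (4 - d) < 0 := by linarith
  have hc0 : c < 0 := div_neg_of_pos_of_neg (by linarith) h4
  have hc1 : 2 * c ≠ 1 := by linarith
  have h1 := h.sq_smul_of_adConj_eq hs hJ hc1 hP
  by_cases hφ : lieContraction e (defect K Φ) = 0
  · simp [hφ]
  · have h2 : (c ^ 2 - 1) • lieContraction e (defect K Φ) = 0 := by
      rw [sub_smul, h1, one_smul, sub_self]
    have h3 := (smul_eq_zero.1 h2).resolve_right hφ
    have h5 : c = -1 := by nlinarith
    have h6 := h.smul_lie_of_adConj_eq hs hJ hc1 hP W Z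
    rw [h5, neg_one_smul] at h6
    exact neg_injective h6

end IsBianchiPair_s7

section PositiveDefinite

variable {V : Type*} [AddCommGroup V] [Module ℝ V] {B : LinearMap.BilinForm ℝ V}

/-- The inner product structure defined by a positive definite symmetric bilinear form. -/
noncomputable abbrev innerCoreOfBilin (B : LinearMap.BilinForm ℝ V) (hB : ∀ X Y, B X Y = B Y X)
    (hpos : ∀ X, X ≠ 0 → 0 < B X X) : InnerProductSpace.Core ℝ V where
  inner X Y := B X Y
  conj_inner_symm X Y := hB Y X
  re_inner_nonneg X := by
    by_cases hX : X = 0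
    · simp [hX]
    · exact (hpos X hX).le
  add_left X Y Z := by simp
  smul_left X Y r := by simp
  definite X hX := by
    by_contra h
    exact (hpos X h).ne' hX

theorem exists_expand_of_posDef [Module.Finite ℝ V] (hB : ∀ X Y, B X Y = B Y X)
    (hpos : ∀ X, X ≠ 0 → 0 < B X X) :
    ∃ (n : ℕ) (e : Fin n → V), ∀ X, ∑ i, B X (e i) • e i = X := by
  let c := innerCoreOfBilin B hB hpos
  let : NormedAddCommGroup V := c.toNormedAddCommGroup
  let : InnerProductSpace ℝ V := .ofCore c.toCore
  refine ⟨_, stdOrthonormalBasis ℝ V, fun X => ?_⟩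
  refine Eq.trans (Finset.sum_congr rfl fun i _ => ?_) ((stdOrthonormalBasis ℝ V).sum_repr' X)
  exact congrArg (fun r : ℝ => r • stdOrthonormalBasis ℝ V i) (hB _ _)

theorem exists_hasEigenvalue_of_posDef [Module.Finite ℝ V] [Nontrivial V]
    (hB : ∀ X Y, B X Y = B Y X) (hpos : ∀ X, X ≠ 0 → 0 < B X X) {A : Module.End ℝ V}
    (hA : ∀ X Y, B (A X) Y = B X (A Y)) : ∃ μ : ℝ, A.HasEigenvalue μ := by
  let c := innerCoreOfBilin B hB hpos
  let : NormedAddCommGroup V := c.toNormedAddCommGroup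
  let : InnerProductSpace ℝ V := .ofCore c.toCore
  exact ⟨_, LinearMap.IsSymmetric.hasEigenvalue_iSup_of_finiteDimensional hA⟩

end PositiveDefinite

section Killing

variable {g : Type*} [LieRing g] [LieAlgebra ℝ g]

theorem exists_invariantFrame [Module.Finite ℝ g]
    (hneg : ∀ X : g, X ≠ 0 → killingForm ℝ g X X < 0) :
    ∃ (n : ℕ) (e : Fin n → g), InvariantFrame (-killingForm ℝ g) e := by
  have hsymm : ∀ X Y : g, (-killingForm ℝ g) X Y = (-killingForm ℝ g) Y X := fun X Y =>
    congrArg Neg.neg (LieModule.traceForm_comm ℝ g g X Y)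
  have hinv : ∀ X Y Z : g, (-killingForm ℝ g) ⁅X, Y⁆ Z = (-killingForm ℝ g) X ⁅Y, Z⁆ :=
    fun X Y Z => congrArg Neg.neg (LieModule.traceForm_apply_lie_apply ℝ g g X Y Z)
  obtain ⟨n, e, he⟩ := exists_expand_of_posDef (B := -killingForm ℝ g) hsymm fun X hX =>
    neg_pos.2 (hneg X hX)
  refine ⟨n, e, hsymm, hinv, he, fun X => ?_⟩
  have hc : ∀ Y, (-killingForm ℝ g) (∑ i, ⁅e i, ⁅e i, X⁆⁆) Y = (-killingForm ℝ g) (-X) Y := by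
    intro Y
    have h1 : killingForm ℝ g Y X = ∑ i, (-killingForm ℝ g) ⁅Y, ⁅X, e i⁆⁆ (e i) :=
      trace_eq_sum_of_expand hsymm he (ad ℝ g Y ∘ₗ ad ℝ g X)
    have h2 : (-killingForm ℝ g) (-X) Y = killingForm ℝ g Y X := by
      rw [hsymm, map_neg, LinearMap.neg_apply, LinearMap.neg_apply, neg_neg]
    rw [h2, h1, hsymm, map_sum]
    refine Finset.sum_congr rfl fun i _ => ?_
    rw [hinv, ← lie_skew ⁅X, e i⁆, ← lie_skew X, lie_neg, neg_neg]
  rw [← sub_eq_zero, ← he (_ - _)]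
  refine Finset.sum_eq_zero fun i _ => ?_
  rw [map_sub, LinearMap.sub_apply, hc, sub_self, zero_smul]

/-- The Schur lemma for an operator with an eigenvalue. -/
theorem eq_smul_of_hasEigenvalue [LieAlgebra.IsSimple ℝ g] {A : Module.End ℝ g}
    (hA : ∀ W Z : g, A ⁅W, Z⁆ = ⁅W, A Z⁆) {μ : ℝ} (hμ : A.HasEigenvalue μ) (X : g) :
    A X = μ • X := by
  let I : LieIdeal ℝ g :=
    { A.eigenspace μ with
      lie_mem := fun {W Z} hZ => by
        have hZ' : A Z = μ • Z := Module.End.mem_eigenspace_iff.1 hZ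
        exact Module.End.mem_eigenspace_iff.2 (by rw [hA, hZ', lie_smul]) }
  have hI : ∀ Z, Z ∈ I ↔ A Z = μ • Z := fun Z => Module.End.mem_eigenspace_iff
  rcases LieAlgebra.IsSimple.eq_bot_or_eq_top (R := ℝ) I with h | h
  · obtain ⟨v, hv⟩ := hμ.exists_hasEigenvector
    have : v ∈ I := (hI v).2 hv.apply_eq_smul
    rw [h, LieSubmodule.mem_bot] at this
    exact absurd this hv.2
  · rw [← hI, h]
    exact LieSubmodule.mem_top X

end Killing

theorem stmt_7 (g : Type*) [LieRing g] [LieAlgebra ℝ g] [Module.Finite ℝ g]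
    [LieAlgebra.IsSimple ℝ g]
    (hneg : ∀ X : g, X ≠ 0 → killingForm ℝ g X X < 0)
    (hdim : 4 < Module.finrank ℝ g)
    (K : g →ₗ[ℝ] Module.End ℝ g)
    (hskew : ∀ Z X Y : g, ip ℝ g (K Z X) Y + ip ℝ g X (K Z Y) = 0)
    (htr : ∀ Z U : g, LinearMap.trace ℝ g (K Z ∘ₗ ad ℝ g U) = 0)
    (Φ : g →ₗ[ℝ] g →ₗ[ℝ] g)
    (hΦalt : ∀ X : g, Φ X X = 0)
    (hi : ∀ X Y Z : g, ip ℝ g (Φ X Y) Z + ip ℝ g (Φ Y Z) X + ip ℝ g (Φ Z X) Y = 0)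
    (hii : ∀ X Y Z : g,
      (⁅ad ℝ g ⁅X, Y⁆, K Z⁆ + ad ℝ g ⁅K X Y - K Y X, Z⁆ + wedge ℝ g (Φ X Y) Z)
      + (⁅ad ℝ g ⁅Y, Z⁆, K X⁆ + ad ℝ g ⁅K Y Z - K Z Y, X⁆ + wedge ℝ g (Φ Y Z) X)
      + (⁅ad ℝ g ⁅Z, X⁆, K Y⁆ + ad ℝ g ⁅K Z X - K X Z, Y⁆ + wedge ℝ g (Φ Z X) Y) = 0)
    :
    ∀ X Y : g, Φ X Y = (1/2 : ℝ) • (K Y X - K X Y) := by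
  obtain ⟨n, e, hf⟩ := exists_invariantFrame hneg
  have hd : ∑ i, (-killingForm ℝ g) (e i) (e i) = (Module.finrank ℝ g : ℝ) := by
    rw [← LinearMap.trace_id, trace_eq_sum_of_expand hf.symm hf.expand]
    rfl
  have hd4 : (4 : ℝ) < (Module.finrank ℝ g : ℝ) := by exact_mod_cast hdim
  have h : IsBianchiPair_s7 (-killingForm ℝ g) e K Φ :=
    { hf with
      skew := fun Z X Y => eq_neg_of_add_eq_zero_left (hskew Z X Y)
      trace_ad := fun Z U => by
        rw [← htr Z U, trace_eq_sum_of_expand hf.symm hf.expand]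
        rfl
      alt := fun X Y => by
        have h1 := hΦalt (X + Y)
        simp only [map_add, LinearMap.add_apply, hΦalt, zero_add, add_zero] at h1
        exact eq_neg_of_add_eq_zero_right h1
      cyclic := hi
      bianchi := fun X Y Z W => LinearMap.congr_fun (hii X Y Z) W }
  have : Nontrivial g := Module.nontrivial_of_finrank_pos (R := ℝ) (by lia)
  obtain ⟨μ, hμ⟩ := exists_hasEigenvalue_of_posDef hf.symm (fun X hX => neg_pos.2 (hneg X hX))
    (hf.lieContraction_symm h.defect_alt h.defect_jacobi)
  have hscalar := eq_smul_of_hasEigenvalue (h.lieContraction_defect_lie hd4 hd) hμ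
  have htrace := h.trace_defect hd4 hd
  simp only [hscalar, map_smul, LinearMap.smul_apply, smul_eq_mul, ← Finset.mul_sum, hd] at htrace
  have hμ0 : μ = 0 := (mul_eq_zero.1 htrace).resolve_right (by linarith)
  intro X Y
  have h1 := hf.curvature_eq h.defect_alt h.defect_jacobi X Y
  rw [hscalar, hμ0, zero_smul, IsBianchiPair_s7.defect_apply] at h1
  linear_combination (norm := module) (1 / 2 : ℝ) • h1
end

section
/- Under the hypotheses of the Proposition (dim g > 4, K and Φ satisfying (i) and (ii)) together with the condition Tr(K_Z ∘ ad_U) = 0 for all Z,U ∈ g, one has σ_{XYZ}⟨K_X Y, Z⟩ = 0 for all X, Y, Z ∈ g. -/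
open LieAlgebra

section DefiniteForm

variable {V : Type*} [AddCommGroup V] [Module ℝ V]

/-- The inner product space core given by the negative of a negative definite symmetric form. -/
@[reducible]
def coreOfNegDef (B : LinearMap.BilinForm ℝ V) (hsymm : ∀ x y, B x y = B y x)
    (hneg : ∀ x, x ≠ 0 → B x x < 0) : InnerProductSpace.Core ℝ V where
  inner x y := -B x y
  conj_inner_symm x y := by simp [hsymm x y]
  re_inner_nonneg x := by
    rcases eq_or_ne x 0 with rfl | hx
    · simp
    · simpa using (hneg x hx).le
  add_left x y z := by simp; ring
  smul_left x y r := by simp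
  definite x h := by
    by_contra hx
    exact (hneg x hx).ne (by simpa using h)

theorem exists_basis_of_negDef [Module.Finite ℝ V] (B : LinearMap.BilinForm ℝ V)
    (hsymm : ∀ x y, B x y = B y x) (hneg : ∀ x, x ≠ 0 → B x x < 0) :
    ∃ e : Fin (Module.finrank ℝ V) → V, (∀ i, B (e i) (e i) = -1) ∧
      ∀ f : Module.End ℝ V, LinearMap.trace ℝ V f = -∑ i, B (e i) (f (e i)) := by
  let c := coreOfNegDef B hsymm hneg
  let _ : NormedAddCommGroup V := c.toNormedAddCommGroup
  let _ : InnerProductSpace ℝ V := InnerProductSpace.ofCore c.toCore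
  let b := stdOrthonormalBasis ℝ V
  have hin : ∀ x y : V, inner ℝ x y = -B x y := fun _ _ => rfl
  refine ⟨b, fun i => ?_, fun f => ?_⟩
  · have h := b.inner_eq_one i
    rw [hin] at h
    linarith
  · rw [LinearMap.trace_eq_sum_inner f b]
    simp [hin]

theorem exists_eigenvector_of_negDef [Module.Finite ℝ V] [Nontrivial V] (B : LinearMap.BilinForm ℝ V)
    (hsymm : ∀ x y, B x y = B y x) (hneg : ∀ x, x ≠ 0 → B x x < 0)
    (D : Module.End ℝ V) (hD : ∀ x y, B (D x) y = B x (D y)) :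
    ∃ (r : ℝ) (v : V), v ≠ 0 ∧ D v = r • v := by
  let c := coreOfNegDef B hsymm hneg
  let _ : NormedAddCommGroup V := c.toNormedAddCommGroup
  let _ : InnerProductSpace ℝ V := InnerProductSpace.ofCore c.toCore
  have hin : ∀ x y : V, inner ℝ x y = -B x y := fun _ _ => rfl
  have hT : D.IsSymmetric := fun x y => by rw [hin, hin, hD]
  obtain ⟨v, hv⟩ := hT.hasEigenvalue_iSup_of_finiteDimensional.exists_hasEigenvector
  exact ⟨_, v, hv.2, hv.apply_eq_smul⟩

theorem nondegenerate_of_negDef (B : LinearMap.BilinForm ℝ V)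
    (hneg : ∀ x, x ≠ 0 → B x x < 0) : B.Nondegenerate := by
  have key : ∀ x, B x x = 0 → x = 0 := fun x h => by
    by_contra hx
    exact (hneg x hx).ne h
  exact ⟨fun x h => key x (h x), fun x h => key x (h x)⟩

theorem trace_eq_of_adjoint [Module.Finite ℝ V] (B : LinearMap.BilinForm ℝ V)
    (hsymm : ∀ x y, B x y = B y x) (hneg : ∀ x, x ≠ 0 → B x x < 0) (f f' : Module.End ℝ V)
    (h : ∀ x y, B (f x) y = B x (f' y)) :
    LinearMap.trace ℝ V f = LinearMap.trace ℝ V f' := by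
  obtain ⟨e, -, he⟩ := exists_basis_of_negDef B hsymm hneg
  rw [he, he]
  congr 1
  exact Finset.sum_congr rfl fun i _ => by rw [← h, hsymm]

end DefiniteForm

section KillingForm

variable {g : Type*} [LieRing g] [LieAlgebra ℝ g]

theorem killingForm_symm (x y : g) : killingForm ℝ g x y = killingForm ℝ g y x :=
  LieModule.traceForm_comm ℝ g g x y

theorem killingForm_lie (x y z : g) :
    killingForm ℝ g ⁅x, y⁆ z = killingForm ℝ g x ⁅y, z⁆ :=
  LieModule.traceForm_apply_lie_apply ℝ g g x y z

theorem killingForm_lie_left (x y z : g) :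
    killingForm ℝ g ⁅x, y⁆ z = -killingForm ℝ g y ⁅x, z⁆ := by
  rw [← lie_skew, map_neg, LinearMap.neg_apply, killingForm_lie]

theorem eq_zero_of_killingForm_lie_eq_zero
    (hneg : ∀ X : g, X ≠ 0 → killingForm ℝ g X X < 0) (w : g)
    (h : ∀ u v : g, killingForm ℝ g w ⁅u, v⁆ = 0) : w = 0 := by
  have hB := nondegenerate_of_negDef _ hneg
  have had : ad ℝ g w = 0 := LinearMap.ext fun u =>
    hB.1 _ fun v => by rw [ad_apply, killingForm_lie, h]
  by_contra hw
  refine (hneg w hw).ne ?_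
  rw [killingForm_apply_apply, had]
  simp

theorem ad_lie_eq_sub (x y : g) :
    ad ℝ g ⁅x, y⁆ = ad ℝ g x * ad ℝ g y - ad ℝ g y * ad ℝ g x := by
  ext z
  simp only [ad_apply, LinearMap.sub_apply, Module.End.mul_apply, lie_lie]

theorem range_lift_lie_eq_top [Module.Finite ℝ g]
    (hneg : ∀ X : g, X ≠ 0 → killingForm ℝ g X X < 0) :
    LinearMap.range (TensorProduct.lift (LieModule.toEnd ℝ g g : g →ₗ[ℝ] g →ₗ[ℝ] g)) = ⊤ := by
  by_contra htop
  obtain ⟨f, hf0, hf⟩ := Submodule.exists_le_ker_of_lt_top _ (lt_top_iff_ne_top.2 htop)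
  have hB := nondegenerate_of_negDef _ hneg
  have happ : ∀ v, killingForm ℝ g ((LinearMap.BilinForm.toDual _ hB).symm f) v = f v :=
    fun v => LinearMap.BilinForm.apply_toDual_symm_apply f v
  have hw := eq_zero_of_killingForm_lie_eq_zero hneg _ fun u v => by
    rw [happ]
    exact hf ⟨u ⊗ₜ[ℝ] v, by simp⟩
  refine hf0 (LinearMap.ext fun v => ?_)
  rw [← happ, hw]
  simp

/-- An alternating `g`-valued form `S` for which `ad ∘ S` satisfies the first Bianchi identity has
the pair symmetry of a curvature tensor. -/
theorem killingForm_pair_symm (S : g →ₗ[ℝ] g →ₗ[ℝ] g) (halt : ∀ X, S X X = 0)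
    (hS : ∀ X Y Z : g, ⁅S X Y, Z⁆ + ⁅S Y Z, X⁆ + ⁅S Z X, Y⁆ = 0) (X Y U V : g) :
    killingForm ℝ g (S X Y) ⁅U, V⁆ = killingForm ℝ g (S U V) ⁅X, Y⁆ := by
  have hskew : ∀ X Y, S X Y = -S Y X := fun X Y => by
    have h := halt (X + Y)
    simp only [map_add, LinearMap.add_apply, halt, zero_add, add_zero] at h
    exact eq_neg_of_add_eq_zero_right h
  have hb : ∀ X Y Z W : g, killingForm ℝ g (S X Y) ⁅Z, W⁆ + killingForm ℝ g (S Y Z) ⁅X, W⁆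
      + killingForm ℝ g (S Z X) ⁅Y, W⁆ = 0 := fun X Y Z W => by
    rw [← killingForm_lie, ← killingForm_lie, ← killingForm_lie, ← LinearMap.add_apply,
      ← LinearMap.add_apply, ← map_add, ← map_add, hS]
    simp
  have ha : ∀ X Y Z W : g, killingForm ℝ g (S X Y) ⁅Z, W⁆ = -killingForm ℝ g (S Y X) ⁅Z, W⁆ :=
    fun X Y Z W => by rw [hskew X Y, map_neg, LinearMap.neg_apply]
  have hc : ∀ X Y Z W : g, killingForm ℝ g (S X Y) ⁅Z, W⁆ = -killingForm ℝ g (S X Y) ⁅W, Z⁆ :=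
    fun X Y Z W => by rw [← lie_skew, map_neg]
  linarith [hb X Y U V, hb Y U V X, hb U V X Y, hb V X Y U,
    ha X U Y V, hc X U Y V, ha U X V Y, hc U X V Y, ha Y V X U, hc Y V X U, ha V Y U X,
    hc V Y U X, hc X Y U V, hc Y U V X, hc U V X Y, hc V X Y U, ha X Y U V, ha U V X Y,
    ha Y U V X, ha V X Y U, ha X Y V U, ha U V Y X, ha Y U X V, ha V X U Y]

/-- Such a form factors through the Lie bracket via a self-adjoint endomorphism. -/
theorem exists_eq_comp_lie [Module.Finite ℝ g]
    (hneg : ∀ X : g, X ≠ 0 → killingForm ℝ g X X < 0)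
    (S : g →ₗ[ℝ] g →ₗ[ℝ] g) (halt : ∀ X, S X X = 0)
    (hS : ∀ X Y Z : g, ⁅S X Y, Z⁆ + ⁅S Y Z, X⁆ + ⁅S Z X, Y⁆ = 0) :
    ∃ A : Module.End ℝ g, (∀ X Y : g, S X Y = A ⁅X, Y⁆) ∧
      ∀ X Y : g, killingForm ℝ g (A X) Y = killingForm ℝ g X (A Y) := by
  have hrange := range_lift_lie_eq_top hneg
  set b := TensorProduct.lift (LieModule.toEnd ℝ g g : g →ₗ[ℝ] g →ₗ[ℝ] g) with hb
  have hbt : ∀ U V : g, b (U ⊗ₜ[ℝ] V) = ⁅U, V⁆ := fun U V => by simp [hb]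
  have hpair : ∀ t t', killingForm ℝ g (TensorProduct.lift S t) (b t')
      = killingForm ℝ g (TensorProduct.lift S t') (b t) := by
    intro t t'
    induction t with
    | zero => simp
    | add x y hx hy => simp [hx, hy]
    | tmul X Y =>
      induction t' with
      | zero => simp
      | add x y hx hy => simp only [map_add, LinearMap.add_apply, hx, hy]
      | tmul U V =>
        rw [hbt, hbt, TensorProduct.lift.tmul, TensorProduct.lift.tmul]
        exact killingForm_pair_symm S halt hS X Y U V
  have hker : ∀ t, b t = 0 → TensorProduct.lift S t = 0 := fun t ht =>
    eq_zero_of_killingForm_lie_eq_zero hneg _ fun u v => by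
      rw [← hbt, hpair, ht, map_zero]
  obtain ⟨s, hs⟩ := b.exists_rightInverse_of_surjective hrange
  have hs' : ∀ x, b (s x) = x := fun x => LinearMap.congr_fun hs x
  refine ⟨TensorProduct.lift S ∘ₗ s, fun X Y => ?_, fun X Y => ?_⟩
  · have h := hker (X ⊗ₜ[ℝ] Y - s ⁅X, Y⁆) (by rw [map_sub, hs', hbt, sub_self])
    rw [map_sub, sub_eq_zero, TensorProduct.lift.tmul] at h
    exact h
  · have h := hpair (s X) (s Y)
    rw [hs', hs'] at h
    rw [killingForm_symm X]
    exact h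

/-- On a simple Lie algebra with negative definite Killing form, every invariant symmetric
bilinear form is a multiple of the Killing form. -/
theorem exists_eq_smul_killingForm [Module.Finite ℝ g] [LieAlgebra.IsSimple ℝ g]
    (hneg : ∀ X : g, X ≠ 0 → killingForm ℝ g X X < 0) (h : LinearMap.BilinForm ℝ g)
    (hsymm : ∀ x y, h x y = h y x) (hinv : ∀ x y z : g, h ⁅x, y⁆ z = h x ⁅y, z⁆) :
    ∃ r : ℝ, ∀ x y, h x y = r * killingForm ℝ g x y := by
  have hB := nondegenerate_of_negDef _ hneg
  let D : Module.End ℝ g := (LinearMap.BilinForm.toDual _ hB).symm.toLinearMap ∘ₗ h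
  have hD : ∀ x y, killingForm ℝ g (D x) y = h x y :=
    fun x y => LinearMap.BilinForm.apply_toDual_symm_apply (hB := hB) (h x) y
  have : Nontrivial g := by
    by_contra hn
    rw [not_nontrivial_iff_subsingleton] at hn
    exact LieAlgebra.IsSimple.non_abelian ℝ (L := g) ⟨fun _ _ => Subsingleton.elim _ _⟩
  obtain ⟨r, v, hv0, hv⟩ := exists_eigenvector_of_negDef _ killingForm_symm hneg D
    fun x y => by rw [hD, killingForm_symm, hD, hsymm]
  have hcomm : ∀ x y : g, D ⁅x, y⁆ = ⁅x, D y⁆ := fun x y => by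
    refine sub_eq_zero.1 (hB.1 _ fun z => ?_)
    rw [map_sub, LinearMap.sub_apply, hD, killingForm_lie_left, hD, ← lie_skew, map_neg,
      LinearMap.neg_apply, hinv, sub_self]
  let I : LieIdeal ℝ g :=
    { Module.End.eigenspace D r with
      lie_mem := fun {x m} hm => by
        have hm' : D m = r • m := Module.End.mem_eigenspace_iff.1 hm
        change ⁅x, m⁆ ∈ Module.End.eigenspace D r
        rw [Module.End.mem_eigenspace_iff, hcomm, hm', lie_smul] }
  have hvI : v ∈ I := Module.End.mem_eigenspace_iff.2 hv
  have hI : I = ⊤ := (LieAlgebra.IsSimple.eq_bot_or_eq_top I).resolve_left fun hbot => by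
    rw [hbot] at hvI
    exact hv0 hvI
  refine ⟨r, fun x y => ?_⟩
  have hx : x ∈ I := hI ▸ LieSubmodule.mem_top x
  have hx' : D x = r • x := Module.End.mem_eigenspace_iff.1 hx
  rw [← hD, hx', map_smul, LinearMap.smul_apply, smul_eq_mul]

/-- The alternation of a `g`-valued form satisfying the first Bianchi identity is a multiple of
the Cartan three-form. -/
theorem exists_cyclic_sum_eq_smul [Module.Finite ℝ g] [LieAlgebra.IsSimple ℝ g]
    (hneg : ∀ X : g, X ≠ 0 → killingForm ℝ g X X < 0)
    (S : g →ₗ[ℝ] g →ₗ[ℝ] g) (halt : ∀ X, S X X = 0)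
    (hS : ∀ X Y Z : g, ⁅S X Y, Z⁆ + ⁅S Y Z, X⁆ + ⁅S Z X, Y⁆ = 0) :
    ∃ r : ℝ, ∀ X Y Z : g, killingForm ℝ g (S X Y) Z + killingForm ℝ g (S Y Z) X
      + killingForm ℝ g (S Z X) Y = r * killingForm ℝ g ⁅X, Y⁆ Z := by
  obtain ⟨A, hSA, hA⟩ := exists_eq_comp_lie hneg S halt hS
  simp only [hSA] at hS ⊢
  have hop : ∀ X Y : g, ad ℝ g (A ⁅X, Y⁆)
      = ad ℝ g X * A * ad ℝ g Y - ad ℝ g Y * A * ad ℝ g X := fun X Y => by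
    ext Z
    have h := hS X Y Z
    rw [← lie_skew (A ⁅Y, Z⁆), ← lie_skew (A ⁅Z, X⁆), ← lie_skew Z X, map_neg, lie_neg, neg_neg,
      add_assoc] at h
    simp only [LinearMap.sub_apply, Module.End.mul_apply, ad_apply]
    rw [eq_neg_of_add_eq_zero_left h]
    abel
  have htrans : ∀ X Y W : g, LinearMap.trace ℝ g (A * ad ℝ g X * ad ℝ g W * ad ℝ g Y)
      = -LinearMap.trace ℝ g (A * ad ℝ g Y * ad ℝ g W * ad ℝ g X) := fun X Y W => by
    have h := trace_eq_of_adjoint _ killingForm_symm hneg (A * ad ℝ g X * ad ℝ g W * ad ℝ g Y)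
      (-(ad ℝ g Y * ad ℝ g W * ad ℝ g X * A)) fun u v => by
        simp only [Module.End.mul_apply, ad_apply, LinearMap.neg_apply]
        rw [hA, killingForm_lie_left, killingForm_lie_left, killingForm_lie_left, map_neg, neg_neg]
    rw [h, map_neg, LinearMap.trace_mul_comm]
    simp only [mul_assoc]
  let q : LinearMap.BilinForm ℝ g := LinearMap.mk₂ ℝ
    (fun X Y => LinearMap.trace ℝ g (A * ad ℝ g X * ad ℝ g Y))
    (by intros; simp [mul_add, add_mul]) (by intros; simp)
    (by intros; simp [mul_add]) (by intros; simp)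
  have hq : ∀ X Y, q X Y = LinearMap.trace ℝ g (A * ad ℝ g X * ad ℝ g Y) := fun _ _ => rfl
  have hqsymm : ∀ X Y, q X Y = q Y X := fun X Y => by
    rw [hq, hq, trace_eq_of_adjoint _ killingForm_symm hneg (A * ad ℝ g X * ad ℝ g Y)
      (ad ℝ g Y * ad ℝ g X * A) fun u v => by
        simp only [Module.End.mul_apply, ad_apply]
        rw [hA, killingForm_lie_left, killingForm_lie_left, neg_neg],
      LinearMap.trace_mul_comm, mul_assoc]
  have htwo : ∀ X Y W : g, killingForm ℝ g (A ⁅X, Y⁆) W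
      = 2 * LinearMap.trace ℝ g (A * ad ℝ g Y * ad ℝ g W * ad ℝ g X) := fun X Y W => by
    have h1 : LinearMap.trace ℝ g (ad ℝ g X * A * ad ℝ g Y * ad ℝ g W)
        = LinearMap.trace ℝ g (A * ad ℝ g Y * ad ℝ g W * ad ℝ g X) := by
      rw [mul_assoc, mul_assoc, LinearMap.trace_mul_comm]
      simp only [mul_assoc]
    have h2 : LinearMap.trace ℝ g (ad ℝ g Y * A * ad ℝ g X * ad ℝ g W)
        = LinearMap.trace ℝ g (A * ad ℝ g X * ad ℝ g W * ad ℝ g Y) := by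
      rw [mul_assoc, mul_assoc, LinearMap.trace_mul_comm]
      simp only [mul_assoc]
    rw [killingForm_apply_apply, ← Module.End.mul_eq_comp, hop, sub_mul, map_sub, h1, h2,
      htrans X Y W]
    ring
  have hdiff : ∀ X Y W : g, killingForm ℝ g (A ⁅X, Y⁆) W + killingForm ℝ g (A ⁅W, X⁆) Y
      = 2 * q ⁅Y, W⁆ X := fun X Y W => by
    have h : LinearMap.trace ℝ g (A * ad ℝ g ⁅Y, W⁆ * ad ℝ g X)
        = LinearMap.trace ℝ g (A * ad ℝ g Y * ad ℝ g W * ad ℝ g X)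
          - LinearMap.trace ℝ g (A * ad ℝ g W * ad ℝ g Y * ad ℝ g X) := by
      rw [ad_lie_eq_sub, mul_sub, sub_mul, map_sub]
      simp only [mul_assoc]
    rw [← lie_skew W X, map_neg, map_neg, LinearMap.neg_apply, htwo, htwo, hq, h]
    ring
  let k : LinearMap.BilinForm ℝ g := (2 : ℝ) • q + killingForm ℝ g ∘ₗ A
  have hk : ∀ X Y, k X Y = 2 * q X Y + killingForm ℝ g (A X) Y := fun _ _ => rfl
  obtain ⟨r, hr⟩ := exists_eq_smul_killingForm hneg k
    (fun X Y => by rw [hk, hk, hqsymm, hA, killingForm_symm X]) fun X Y Z => by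
      have hk' : k X ⁅Y, Z⁆ = k ⁅Y, Z⁆ X := by
        rw [hk, hk, hqsymm, hA, killingForm_symm X]
      rw [hk', hk, hk]
      linarith [hdiff X Y Z, hdiff Z X Y]
  refine ⟨r, fun X Y Z => ?_⟩
  rw [← hr, hk]
  linarith [hdiff Z X Y]

theorem trace_wedge_comp_ad [Module.Finite ℝ g] (P Z W : g) :
    LinearMap.trace ℝ g (wedge ℝ g P Z ∘ₗ ad ℝ g W) = 2 * killingForm ℝ g ⁅P, Z⁆ W := by
  have h : ∀ (f : g →ₗ[ℝ] ℝ) (x : g),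
      LinearMap.trace ℝ g (f.smulRight x ∘ₗ ad ℝ g W) = f ⁅W, x⁆ := fun f x => by
    have hc : f.smulRight x ∘ₗ ad ℝ g W = (f ∘ₗ ad ℝ g W).smulRight x := rfl
    rw [hc, LinearMap.trace_smulRight]
    rfl
  rw [wedge, LinearMap.sub_comp, map_sub, h, h, LinearMap.neg_apply, LinearMap.neg_apply,
    killingForm_lie P Z W, ← lie_skew W Z, map_neg, ← killingForm_lie Z W P,
    killingForm_symm ⁅Z, W⁆ P]
  ring

theorem trace_lie_ad_comp_ad [Module.Finite ℝ g] (f : Module.End ℝ g)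
    (hf : ∀ U, LinearMap.trace ℝ g (f ∘ₗ ad ℝ g U) = 0) (U W : g) :
    LinearMap.trace ℝ g (⁅ad ℝ g U, f⁆ ∘ₗ ad ℝ g W) = 0 := by
  have h := hf ⁅W, U⁆
  rw [← Module.End.mul_eq_comp, ad_lie_eq_sub, mul_sub, map_sub] at h
  rw [← Module.End.mul_eq_comp, Ring.lie_def, sub_mul, map_sub, mul_assoc,
    LinearMap.trace_mul_comm, mul_assoc, mul_assoc]
  exact h

/-- If every `K X` is orthogonal to `ad g`, the alternation of `K` is orthogonal to the Cartan
three-form. -/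
theorem eq_zero_of_cyclic_sum_eq_smul [Module.Finite ℝ g] [Nontrivial g]
    (hneg : ∀ X : g, X ≠ 0 → killingForm ℝ g X X < 0) (K : g →ₗ[ℝ] Module.End ℝ g)
    (hskew : ∀ Z X Y : g, killingForm ℝ g (K Z X) Y = -killingForm ℝ g X (K Z Y))
    (htr : ∀ Z U : g, LinearMap.trace ℝ g (K Z ∘ₗ ad ℝ g U) = 0) (r : ℝ)
    (hr : ∀ X Y Z : g, killingForm ℝ g (K X Y) Z + killingForm ℝ g (K Y Z) X
      + killingForm ℝ g (K Z X) Y = r * killingForm ℝ g ⁅X, Y⁆ Z) : r = 0 := by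
  obtain ⟨e, he, htrace⟩ := exists_basis_of_negDef _ killingForm_symm hneg
  have hcontr : ∀ X : g, -2 * ∑ i, killingForm ℝ g ⁅X, e i⁆ (K (e i) X)
      = r * killingForm ℝ g X X := fun X => by
    have h1 : ∑ i, killingForm ℝ g (K X (e i)) ⁅X, e i⁆ = 0 := by
      rw [← htr X X, htrace, ← Finset.sum_neg_distrib]
      exact Finset.sum_congr rfl fun i _ => hskew _ _ _
    have h2 : ∑ i, killingForm ℝ g (K (e i) ⁅X, e i⁆) X
        = -∑ i, killingForm ℝ g ⁅X, e i⁆ (K (e i) X) := by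
      rw [← Finset.sum_neg_distrib]
      exact Finset.sum_congr rfl fun i _ => hskew _ _ _
    have h3 : ∑ i, killingForm ℝ g (K ⁅X, e i⁆ X) (e i)
        = -∑ i, killingForm ℝ g ⁅X, e i⁆ (K (e i) X) := by
      have h := LinearMap.trace_mul_comm ℝ (K.flip X) (ad ℝ g X)
      rw [htrace, htrace, neg_inj] at h
      rw [← Finset.sum_neg_distrib]
      refine (Finset.sum_congr rfl fun i _ => killingForm_symm _ _).trans (h.trans ?_)
      refine Finset.sum_congr rfl fun i _ => ?_
      rw [killingForm_lie_left, neg_neg]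
      rfl
    have h4 : ∑ i, killingForm ℝ g ⁅X, e i⁆ ⁅X, e i⁆ = killingForm ℝ g X X := by
      rw [killingForm_apply_apply, htrace, ← Finset.sum_neg_distrib]
      exact Finset.sum_congr rfl fun i _ => killingForm_lie_left _ _ _
    have h := Finset.sum_congr rfl fun i (_ : i ∈ Finset.univ) => hr X (e i) ⁅X, e i⁆
    rw [Finset.sum_add_distrib, Finset.sum_add_distrib, h1, h2, h3, ← Finset.mul_sum, h4] at h
    linarith
  have hzero : ∑ j, ∑ i, killingForm ℝ g ⁅e j, e i⁆ (K (e i) (e j)) = 0 := by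
    rw [Finset.sum_comm]
    refine Finset.sum_eq_zero fun i _ => ?_
    have h := htr (e i) (e i)
    rw [← Module.End.mul_eq_comp, LinearMap.trace_mul_comm, htrace, neg_eq_zero] at h
    rw [← h]
    refine Finset.sum_congr rfl fun j _ => ?_
    rw [killingForm_lie]
    rfl
  have h := Finset.sum_congr rfl fun j (_ : j ∈ Finset.univ) => hcontr (e j)
  rw [← Finset.mul_sum, hzero] at h
  simpa [he, (Module.finrank_pos (R := ℝ) (M := g)).ne'] using h

end KillingForm

theorem stmt_9 (g : Type*) [LieRing g] [LieAlgebra ℝ g] [Module.Finite ℝ g]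
    [LieAlgebra.IsSimple ℝ g]
    (hneg : ∀ X : g, X ≠ 0 → killingForm ℝ g X X < 0)
    (hdim : 4 < Module.finrank ℝ g)
    (K : g →ₗ[ℝ] Module.End ℝ g)
    (hskew : ∀ Z X Y : g, ip ℝ g (K Z X) Y + ip ℝ g X (K Z Y) = 0)
    (htr : ∀ Z U : g, LinearMap.trace ℝ g (K Z ∘ₗ ad ℝ g U) = 0)
    (Φ : g →ₗ[ℝ] g →ₗ[ℝ] g)
    (hΦalt : ∀ X : g, Φ X X = 0)
    (hi : ∀ X Y Z : g, ip ℝ g (Φ X Y) Z + ip ℝ g (Φ Y Z) X + ip ℝ g (Φ Z X) Y = 0)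
    (hii : ∀ X Y Z : g,
      (⁅ad ℝ g ⁅X, Y⁆, K Z⁆ + ad ℝ g ⁅K X Y - K Y X, Z⁆ + wedge ℝ g (Φ X Y) Z)
      + (⁅ad ℝ g ⁅Y, Z⁆, K X⁆ + ad ℝ g ⁅K Y Z - K Z Y, X⁆ + wedge ℝ g (Φ Y Z) X)
      + (⁅ad ℝ g ⁅Z, X⁆, K Y⁆ + ad ℝ g ⁅K Z X - K X Z, Y⁆ + wedge ℝ g (Φ Z X) Y) = 0)
    :
    ∀ X Y Z : g, ip ℝ g (K X Y) Z + ip ℝ g (K Y Z) X + ip ℝ g (K Z X) Y = 0 := by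
  have hB := nondegenerate_of_negDef _ hneg
  have : Nontrivial g := Module.nontrivial_of_finrank_pos (R := ℝ) (by omega)
  let S : g →ₗ[ℝ] g →ₗ[ℝ] g := K - K.flip + (2 : ℝ) • Φ
  have hSdef : ∀ X Y, S X Y = K X Y - K Y X + (2 : ℝ) • Φ X Y := fun _ _ => rfl
  have hbianchi : ∀ X Y Z : g, ⁅S X Y, Z⁆ + ⁅S Y Z, X⁆ + ⁅S Z X, Y⁆ = 0 := fun X Y Z => by
    refine hB.1 _ fun W => ?_
    have h := congrArg (fun f => LinearMap.trace ℝ g (f ∘ₗ ad ℝ g W)) (hii X Y Z)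
    simp only [LinearMap.add_comp, map_add, LinearMap.zero_comp, map_zero,
      trace_lie_ad_comp_ad _ (htr _), trace_wedge_comp_ad, ← killingForm_apply_apply] at h
    simp only [hSdef, add_lie, smul_lie, map_add, map_smul, LinearMap.add_apply,
      LinearMap.smul_apply, smul_eq_mul]
    linarith
  obtain ⟨r, hr⟩ := exists_cyclic_sum_eq_smul hneg S
    (fun X => by rw [hSdef, hΦalt, sub_self, smul_zero, add_zero]) hbianchi
  simp only [ip] at hi hskew ⊢
  have hskew' : ∀ Z X Y : g, killingForm ℝ g (K Z X) Y = -killingForm ℝ g X (K Z Y) :=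
    fun Z X Y => by linarith [hskew Z X Y]
  have hcyc : ∀ X Y Z : g, killingForm ℝ g (K X Y) Z + killingForm ℝ g (K Y Z) X
      + killingForm ℝ g (K Z X) Y = r / 2 * killingForm ℝ g ⁅X, Y⁆ Z := fun X Y Z => by
    have h := hr X Y Z
    simp only [hSdef, map_add, map_sub, map_smul, LinearMap.add_apply, LinearMap.sub_apply,
      LinearMap.smul_apply, smul_eq_mul] at h
    linarith [hi X Y Z, hskew' Y X Z, hskew' Z Y X, hskew' X Z Y,
      killingForm_symm X (K Y Z), killingForm_symm Y (K Z X), killingForm_symm Z (K X Y)]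
  intro X Y Z
  have h := hcyc X Y Z
  rw [eq_zero_of_cyclic_sum_eq_smul hneg K hskew' htr _ hcyc] at h
  linarith
end
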